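/- arXiv:2512.16326 — 11 statements merged into one kernel-verified Lean document; each statement's English description precedes it below -/
import Mathlib

section
/- (Kelly–Postle) If G is a finite simple graph and g : V(G) → ℝ is a function such that g(v) ≤ 2/(2·d_G(v)+1) for every vertex v, and Σ_{v ∈ K} g(v) ≤ 1 for every clique K ⊆ V(G), then α(G) ≥ Σ_{v ∈ V(G)} g(v). -/
/-- A set of vertices is independent if its elements are pairwise nonadjacent. -/
def IsIndepSet {V : Type*} (G : SimpleGraph V) (s : Set V) : Prop :=
  s.Pairwise fun a b => ¬ G.Adj a b

/-- The independence number: the largest cardinality of an independent set of vertices. -/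
noncomputable def indepNum {V : Type*} [Fintype V] (G : SimpleGraph V) : ℕ :=
  sSup {n | ∃ s : Finset V, IsIndepSet G ↑s ∧ s.card = n}

open Classical in
/-- The neighbours of `v` inside the finite set `W`. -/
noncomputable def nbrIn {V : Type*} (G : SimpleGraph V) (W : Finset V) (v : V) : Finset V :=
  W.filter (G.Adj v)

theorem mem_nbrIn {V : Type*} {G : SimpleGraph V} {W : Finset V} {v u : V} :
    u ∈ nbrIn G W v ↔ u ∈ W ∧ G.Adj v u := by
  simp [nbrIn]

/-- A nonnegative weight on `W` bounded by `2 / (2 d + 1)` at vertices of degree `d` in `G[W]`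
and by `1` in total on cliques. -/
structure IsDemand {V : Type*} (G : SimpleGraph V) (W : Finset V) (g : V → ℝ) : Prop where
  nonneg : ∀ v, 0 ≤ g v
  le_degree : ∀ v ∈ W, g v ≤ 2 / (2 * ((nbrIn G W v).card : ℝ) + 1)
  clique_le : ∀ K ⊆ W, G.IsClique (K : Set V) → ∑ v ∈ K, g v ≤ 1

/-- `G[W]` has an independent set of size at least the total weight of `W`. -/
def HasLargeIndep {V : Type*} (G : SimpleGraph V) (W : Finset V) (g : V → ℝ) : Prop :=
  ∃ I ⊆ W, IsIndepSet G (I : Set V) ∧ ∑ v ∈ W, g v ≤ (I.card : ℝ)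

theorem two_div_antitone {a b : ℕ} (h : a ≤ b) :
    (2 : ℝ) / (2 * (b : ℝ) + 1) ≤ 2 / (2 * (a : ℝ) + 1) := by
  have : (a : ℝ) ≤ b := by exact_mod_cast h
  gcongr

theorem IsDemand.mono {V : Type*} {G : SimpleGraph V} {W U : Finset V} {g : V → ℝ}
    (h : IsDemand G W g) (hU : U ⊆ W) : IsDemand G U g where
  nonneg := h.nonneg
  le_degree v hv := (h.le_degree v (hU hv)).trans <| two_div_antitone <|
    Finset.card_le_card fun u hu => by
      rw [mem_nbrIn] at hu ⊢
      exact ⟨hU hu.1, hu.2⟩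
  clique_le K hK := h.clique_le K (hK.trans hU)

/-- Removing the closed neighbourhood of an independent set `I` of weight at most `|I|`. -/
theorem HasLargeIndep.of_sdiff {V : Type*} [DecidableEq V] {G : SimpleGraph V} {W : Finset V}
    {g : V → ℝ} {I : Finset V} (hIW : I ⊆ W) (hI : IsIndepSet G (I : Set V))
    (hle : ∑ v ∈ I.biUnion (fun v => insert v (nbrIn G W v)), g v ≤ I.card)
    (hrest : HasLargeIndep G (W \ I.biUnion fun v => insert v (nbrIn G W v)) g) :
    HasLargeIndep G W g := by
  set T := I.biUnion (fun v => insert v (nbrIn G W v)) with hT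
  obtain ⟨J, hJW, hJ, hJc⟩ := hrest
  have hTW : T ⊆ W := by
    intro u hu
    simp only [hT, Finset.mem_biUnion, Finset.mem_insert, mem_nbrIn] at hu
    grind
  have hno : ∀ a ∈ I, ∀ b ∈ J, a ≠ b ∧ ¬ G.Adj a b := by
    intro a ha b hb
    have hb' := Finset.mem_sdiff.1 (hJW hb)
    simp only [hT, Finset.mem_biUnion, Finset.mem_insert, mem_nbrIn] at hb'
    grind
  refine ⟨I ∪ J, Finset.union_subset hIW (hJW.trans Finset.sdiff_subset), ?_, ?_⟩
  · intro a ha b hb hab hadj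
    simp only [Finset.coe_union, Set.mem_union, Finset.mem_coe] at ha hb
    rcases ha with ha | ha <;> rcases hb with hb | hb
    · exact hI ha hb hab hadj
    · exact (hno a ha b hb).2 hadj
    · exact (hno b hb a ha).2 hadj.symm
    · exact hJ ha hb hab hadj
  · rw [Finset.card_union_of_disjoint
      (Finset.disjoint_left.2 fun a ha hb => (hno a ha a hb).1 rfl)]
    rw [← Finset.sum_sdiff hTW]
    push_cast
    linarith

/-- The graph obtained from `G` by joining `x` to all neighbours of a nonadjacent vertex `y`. -/
def joinNbrs {V : Type*} (G : SimpleGraph V) (x y : V) (hxy : ¬ G.Adj x y) : SimpleGraph V where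
  Adj a b := G.Adj a b ∨ (a = x ∧ G.Adj y b) ∨ (b = x ∧ G.Adj y a)
  symm := ⟨fun a b h => by
    rcases h with h | h | h
    · exact Or.inl h.symm
    · exact Or.inr (Or.inr h)
    · exact Or.inr (Or.inl h)⟩
  loopless := ⟨fun a h => by
    rcases h with h | ⟨rfl, h⟩ | ⟨rfl, h⟩
    · exact h.ne rfl
    · exact hxy h.symm
    · exact hxy h.symm⟩

/-- Reduction at a vertex `v` with nonadjacent neighbours `x`, `y`: remove the closed neighbourhood
of `v` except `x`, give `x` the excess weight of that neighbourhood, and join `x` to the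
neighbours of `y`. -/
theorem HasLargeIndep.of_joinNbrs {V : Type*} [DecidableEq V] {G : SimpleGraph V} {W : Finset V}
    {g : V → ℝ} (hg : IsDemand G W g)
    (ih : ∀ (G' : SimpleGraph V) (W' : Finset V) (g' : V → ℝ), W'.card < W.card →
      IsDemand G' W' g' → HasLargeIndep G' W' g')
    {v x y : V} (hv : v ∈ W) (hx : x ∈ nbrIn G W v) (hy : y ∈ nbrIn G W v) (hne : x ≠ y)
    (hxy : ¬ G.Adj x y) (hs0 : 1 ≤ ∑ u ∈ insert v (nbrIn G W v), g u)
    (hs : ∑ u ∈ insert v (nbrIn G W v), g u - 1 ≤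
      1 / (2 * (((nbrIn G W x \ insert v (nbrIn G W v)).card : ℝ) +
        ((nbrIn G W y \ insert v (nbrIn G W v)).card : ℝ)) + 1)) :
    HasLargeIndep G W g := by
  set M := insert v (nbrIn G W v) with hM
  set s := ∑ u ∈ M, g u - 1 with hsdef
  set D := (nbrIn G W x \ M).card + (nbrIn G W y \ M).card with hD
  have hMmem : ∀ u, u ∈ M ↔ u = v ∨ (u ∈ W ∧ G.Adj v u) := by
    intro u; simp [hM, mem_nbrIn]
  have hMW : M ⊆ W := by
    intro u hu
    rcases (hMmem u).1 hu with rfl | h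
    · exact hv
    · exact h.1
  obtain ⟨hxW, hvx⟩ := mem_nbrIn.1 hx
  obtain ⟨hyW, hvy⟩ := mem_nbrIn.1 hy
  have hxM : x ∈ M := (hMmem x).2 (Or.inr ⟨hxW, hvx⟩)
  have hyM : y ∈ M := (hMmem y).2 (Or.inr ⟨hyW, hvy⟩)
  have hvM : v ∈ M := (hMmem v).2 (Or.inl rfl)
  set G' := joinNbrs G x y hxy with hG'
  have hadj : ∀ a b, G'.Adj a b ↔ G.Adj a b ∨ (a = x ∧ G.Adj y b) ∨ (b = x ∧ G.Adj y a) :=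
    fun a b => Iff.rfl
  set W' := insert x (W \ M) with hW'
  set g' := Function.update g x s with hg'
  have hW'mem : ∀ u, u ∈ W' ↔ u = x ∨ (u ∈ W ∧ u ∉ M) := by
    intro u; simp [hW']
  have hW'W : W' ⊆ W := by
    intro u hu
    rcases (hW'mem u).1 hu with rfl | h
    · exact hxW
    · exact h.1
  have hvW' : v ∉ W' := by
    rw [hW'mem]; rintro (h | h)
    · exact hvx.ne h
    · exact h.2 hvM
  have hyW' : y ∉ W' := by
    rw [hW'mem]; rintro (h | h)
    · exact hne h.symm
    · exact h.2 hyM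
  have hgx : g' x = s := by simp [hg']
  have hgne : ∀ u, u ≠ x → g' u = g u := fun u hu => by simp [hg', hu]
  have hs0' : 0 ≤ s := sub_nonneg.2 hs0
  have hsD : s ≤ 1 / (2 * (D : ℝ) + 1) := by rw [hD]; push_cast; exact hs
  have hdx : nbrIn G' W' x ⊆ (nbrIn G W x \ M) ∪ (nbrIn G W y \ M) := by
    intro u hu
    obtain ⟨hu1, hu2⟩ := mem_nbrIn.1 hu
    have hux : u ≠ x := fun h => hu2.ne h.symm
    simp only [Finset.mem_union, Finset.mem_sdiff, mem_nbrIn]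
    have := (hW'mem u).1 hu1
    rw [hadj] at hu2
    grind
  have hdxc : (nbrIn G' W' x).card ≤ D :=
    (Finset.card_le_card hdx).trans (Finset.card_union_le _ _)
  have hdem : IsDemand G' W' g' := by
    refine ⟨?_, ?_, ?_⟩
    · intro u
      by_cases hu : u = x
      · rw [hu, hgx]; exact hs0'
      · rw [hgne u hu]; exact hg.nonneg u
    · intro u hu
      by_cases hux : u = x
      · rw [hux, hgx]
        refine (hsD.trans ?_).trans (two_div_antitone hdxc)
        have hD0 : (0 : ℝ) ≤ D := Nat.cast_nonneg D
        exact div_le_div_of_nonneg_right one_le_two (by linarith)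
      · rw [hgne u hux]
        refine (hg.le_degree u (hW'W hu)).trans (two_div_antitone ?_)
        by_cases hyu : G.Adj y u
        · have hsub : nbrIn G' W' u ⊆ insert x ((nbrIn G W u).erase y) := by
            intro z hz
            obtain ⟨hz1, hz2⟩ := mem_nbrIn.1 hz
            rw [hadj] at hz2
            simp only [Finset.mem_insert, Finset.mem_erase, mem_nbrIn]
            have := hW'W hz1
            grind
          have hymem : y ∈ nbrIn G W u := mem_nbrIn.2 ⟨hyW, hyu.symm⟩
          calc _ ≤ _ := Finset.card_le_card hsub
            _ ≤ ((nbrIn G W u).erase y).card + 1 := Finset.card_insert_le _ _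
            _ = _ := Finset.card_erase_add_one hymem
        · refine Finset.card_le_card fun z hz => ?_
          obtain ⟨hz1, hz2⟩ := mem_nbrIn.1 hz
          rw [hadj] at hz2
          rw [mem_nbrIn]
          refine ⟨hW'W hz1, ?_⟩
          tauto
    · intro K hK hKc
      by_cases hxK : x ∈ K
      · set R := K.erase x with hR
        have hRx : ∀ r ∈ R, r ≠ x := fun r hr => (Finset.mem_erase.1 hr).1
        have hRK : ∀ r ∈ R, r ∈ K := fun r hr => (Finset.mem_erase.1 hr).2
        have hRD : R.card ≤ D := by
          refine le_trans (Finset.card_le_card fun r hr => ?_) hdxc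
          exact mem_nbrIn.2 ⟨hK (hRK r hr), hKc hxK (hRK r hr) (hRx r hr).symm⟩
        have hdeg : ∀ r ∈ R, R.card ≤ (nbrIn G W r).card := by
          intro r hr
          have hclq : ∀ z ∈ R, z ≠ r → G.Adj r z := by
            intro z hz hzr
            have := hKc (hRK r hr) (hRK z hz) hzr.symm
            rw [hadj] at this
            have h1 := hRx r hr
            have h2 := hRx z hz
            tauto
          obtain ⟨z, hzW, hzR, hrz⟩ : ∃ z ∈ W, z ∉ R ∧ G.Adj r z := by
            have := hKc (hRK r hr) hxK (hRx r hr)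
            rw [hadj] at this
            rcases this with h | h | h
            · exact ⟨x, hxW, by simp [hR], h⟩
            · exact absurd h.1 (hRx r hr)
            · exact ⟨y, hyW, fun h' => hyW' (hK (hRK y h')), h.2.symm⟩
          have hsub : insert z (R.erase r) ⊆ nbrIn G W r := by
            intro a ha
            rw [mem_nbrIn]
            rcases Finset.mem_insert.1 ha with rfl | ha
            · exact ⟨hzW, hrz⟩
            · obtain ⟨h1, h2⟩ := Finset.mem_erase.1 ha
              exact ⟨hW'W (hK (hRK a h2)), hclq a h2 h1⟩
          have := Finset.card_le_card hsub
          rwa [Finset.card_insert_of_notMem (fun h => hzR (Finset.mem_of_mem_erase h)),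
            Finset.card_erase_add_one hr] at this
        have hsum : ∑ r ∈ R, g' r ≤ R.card * (2 / (2 * (R.card : ℝ) + 1)) := by
          rw [← nsmul_eq_mul]
          refine Finset.sum_le_card_nsmul _ _ _ fun r hr => ?_
          rw [hgne r (hRx r hr)]
          exact (hg.le_degree r (hW'W (hK (hRK r hr)))).trans (two_div_antitone (hdeg r hr))
        have hsR : s ≤ 1 / (2 * (R.card : ℝ) + 1) := by
          refine hsD.trans ?_
          have : (R.card : ℝ) ≤ D := by exact_mod_cast hRD
          gcongr
        have heq : R.card * (2 / (2 * (R.card : ℝ) + 1)) + 1 / (2 * (R.card : ℝ) + 1) = 1 := by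
          field_simp
        rw [← Finset.add_sum_erase K g' hxK, hgx]
        linarith
      · have hKx : ∀ r ∈ K, r ≠ x := fun r hr h => hxK (h ▸ hr)
        rw [Finset.sum_congr rfl fun r hr => hgne r (hKx r hr)]
        refine hg.clique_le K (hK.trans hW'W) fun a ha b hb hab => ?_
        have := hKc ha hb hab
        rw [hadj] at this
        have h1 := hKx a ha
        have h2 := hKx b hb
        tauto
  have hcard : W'.card < W.card :=
    Finset.card_lt_card ⟨hW'W, fun h => hvW' (h hv)⟩
  obtain ⟨I, hIW, hI, hIc⟩ := ih G' W' g' hcard hdem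
  have hxsd : x ∉ W \ M := fun h => (Finset.mem_sdiff.1 h).2 hxM
  have hsumW' : ∑ u ∈ W', g' u = s + ∑ u ∈ W \ M, g u := by
    rw [hW', Finset.sum_insert hxsd, hgx]
    congr 1
    exact Finset.sum_congr rfl fun u hu => hgne u fun h => hxsd (h ▸ hu)
  have hsumW : ∑ u ∈ W, g u = 1 + ∑ u ∈ W', g' u := by
    rw [hsumW', ← Finset.sum_sdiff hMW, hsdef]; ring
  obtain ⟨z, hzW, hzI, hz⟩ : ∃ z ∈ W, z ∉ I ∧ ∀ a ∈ I, ¬ G.Adj z a := by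
    by_cases hxI : x ∈ I
    · refine ⟨y, hyW, fun h => hyW' (hIW h), fun a ha hya => ?_⟩
      by_cases hax : a = x
      · exact hxy (hax ▸ hya.symm)
      · exact hI hxI ha (Ne.symm hax) ((hadj x a).2 (Or.inr (Or.inl ⟨rfl, hya⟩)))
    · refine ⟨v, hv, fun h => hvW' (hIW h), fun a ha hva => ?_⟩
      rcases (hW'mem a).1 (hIW ha) with rfl | h
      · exact hxI ha
      · exact h.2 ((hMmem a).2 (Or.inr ⟨h.1, hva⟩))
  refine ⟨insert z I, Finset.insert_subset hzW (hIW.trans hW'W), ?_, ?_⟩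
  · intro a ha b hb hab hadj'
    simp only [Finset.coe_insert, Set.mem_insert_iff, Finset.mem_coe] at ha hb
    rcases ha with rfl | ha <;> rcases hb with rfl | hb
    · exact hab rfl
    · exact hz b hb hadj'
    · exact hz a ha hadj'.symm
    · exact hI ha hb hab (Or.inl hadj')
  · rw [Finset.card_insert_of_notMem hzI, hsumW]
    push_cast
    linarith

/-- In a graph of minimum degree `δ` where no independent set of degree-`δ` vertices can be split
off, some vertex of degree `δ` has its degree-`δ` neighbours forming a clique. -/
theorem exists_clique_of_min_degree {V : Type*} [DecidableEq V] {G : SimpleGraph V}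
    {W : Finset V} {g : V → ℝ} (hg : IsDemand G W g) {δ : ℕ}
    (hmin : ∀ u ∈ W, δ ≤ (nbrIn G W u).card) (hne : ∃ u ∈ W, (nbrIn G W u).card = δ)
    (hsplit : ∀ I ⊆ W, I.Nonempty → IsIndepSet G (I : Set V) →
      (I.card : ℝ) < ∑ v ∈ I.biUnion (fun v => insert v (nbrIn G W v)), g v) :
    ∃ v ∈ W, (nbrIn G W v).card = δ ∧
      ∀ a ∈ nbrIn G W v, ∀ b ∈ nbrIn G W v, a ≠ b → (nbrIn G W a).card = δ →
        (nbrIn G W b).card = δ → G.Adj a b := by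
  classical
  set 𝒜 := (W.filter fun u => (nbrIn G W u).card = δ).powerset.filter
    (fun I : Finset V => IsIndepSet G (I : Set V)) with h𝒜
  have hmem : ∀ I : Finset V, I ∈ 𝒜 ↔ (∀ u ∈ I, u ∈ W ∧ (nbrIn G W u).card = δ) ∧
      IsIndepSet G (I : Set V) := by
    intro I
    simp [h𝒜, Finset.subset_iff]
  obtain ⟨I, hI, hmax⟩ := 𝒜.exists_max_image Finset.card
    ⟨∅, (hmem ∅).2 ⟨by simp, by simp [IsIndepSet]⟩⟩
  obtain ⟨hID, hIind⟩ := (hmem I).1 hI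
  have hInon : I.Nonempty := by
    obtain ⟨u, hu, hud⟩ := hne
    have h1 : ({u} : Finset V) ∈ 𝒜 := (hmem _).2 ⟨by simp [hu, hud], by simp [IsIndepSet]⟩
    have := hmax _ h1
    rw [Finset.card_singleton] at this
    exact Finset.card_pos.1 this
  have hIW : I ⊆ W := fun u hu => (hID u hu).1
  have hbound : ∀ u ∈ W, g u ≤ 2 / (2 * (δ : ℝ) + 1) := fun u hu =>
    (hg.le_degree u hu).trans (two_div_antitone (hmin u hu))
  obtain ⟨v, hvI, hpriv⟩ : ∃ v ∈ I, ∀ u ∈ nbrIn G W v, ∀ z ∈ I, G.Adj u z → z = v := by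
    by_contra! hcon
    refine absurd (hsplit I hIW hInon hIind) (not_lt.2 ?_)
    set c : V → ℕ := fun u => (nbrIn G I u).card with hc
    have hcover : I.biUnion (fun v => insert v (nbrIn G W v)) ⊆
        I ∪ W.filter (fun u => 0 < c u) := by
      intro u hu
      simp only [Finset.mem_biUnion, Finset.mem_insert, mem_nbrIn] at hu
      obtain ⟨v, hv, h⟩ := hu
      rcases h with rfl | h
      · exact Finset.mem_union_left _ hv
      · exact Finset.mem_union_right _ (Finset.mem_filter.2 ⟨h.1,
          Finset.card_pos.2 ⟨v, mem_nbrIn.2 ⟨hv, h.2.symm⟩⟩⟩)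
    have hdouble : ∑ v ∈ I, ∑ u ∈ nbrIn G W v, g u / c u =
        ∑ u ∈ W.filter (fun u => 0 < c u), g u := by
      rw [Finset.sum_comm' (t' := W) (s' := fun u => nbrIn G I u)
        (by intro a b; simp only [mem_nbrIn, G.adj_comm b a]; tauto), Finset.sum_filter]
      refine Finset.sum_congr rfl fun u _ => ?_
      rw [Finset.sum_const, nsmul_eq_mul]
      change (c u : ℝ) * _ = _
      split_ifs with h
      · have : (c u : ℝ) ≠ 0 := by exact_mod_cast h.ne'
        field_simp
      · have : c u = 0 := by omega
        simp [this]
    have hlocal : ∀ v ∈ I, g v + ∑ u ∈ nbrIn G W v, g u / c u ≤ 1 := by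
      intro v hv
      obtain ⟨hvW, hvd⟩ := hID v hv
      obtain ⟨u, hu, z, hz, huz, hzv⟩ := hcon v hv
      obtain ⟨huW, hvu⟩ := mem_nbrIn.1 hu
      have hcu : 2 ≤ c u := by
        have : ({z, v} : Finset V) ⊆ nbrIn G I u := by
          intro a ha
          rw [mem_nbrIn]
          rcases Finset.mem_insert.1 ha with rfl | ha
          · exact ⟨hz, huz⟩
          · rw [Finset.mem_singleton.1 ha]; exact ⟨hv, hvu.symm⟩
        have h := Finset.card_le_card this
        rwa [Finset.card_pair hzv] at h
      have h1 : g u / c u ≤ 1 / (2 * (δ : ℝ) + 1) := by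
        have h2 : (2 : ℝ) ≤ c u := by exact_mod_cast hcu
        calc g u / c u ≤ g u / 2 := div_le_div_of_nonneg_left (hg.nonneg u) (by norm_num) h2
          _ ≤ (2 / (2 * (δ : ℝ) + 1)) / 2 := by
              have := hbound u huW
              linarith
          _ = _ := by ring
      have h2 : ∑ a ∈ (nbrIn G W v).erase u, g a / c a ≤
          ((nbrIn G W v).erase u).card * (2 / (2 * (δ : ℝ) + 1)) := by
        rw [← nsmul_eq_mul]
        refine Finset.sum_le_card_nsmul _ _ _ fun a ha => ?_
        obtain ⟨haW, hva⟩ := mem_nbrIn.1 (Finset.mem_of_mem_erase ha)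
        have h3 : 1 ≤ c a := Finset.card_pos.2 ⟨v, mem_nbrIn.2 ⟨hv, hva.symm⟩⟩
        exact (div_le_self (hg.nonneg a) (by exact_mod_cast h3)).trans (hbound a haW)
      have h3 : (((nbrIn G W v).erase u).card : ℝ) + 1 = δ := by
        rw [← hvd]; exact_mod_cast Finset.card_erase_add_one hu
      rw [← Finset.add_sum_erase _ _ hu]
      have h4 := hbound v hvW
      have h5 : (2 / (2 * (δ : ℝ) + 1)) + (1 / (2 * (δ : ℝ) + 1) +
          ((nbrIn G W v).erase u).card * (2 / (2 * (δ : ℝ) + 1))) = 1 := by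
        rw [eq_sub_of_add_eq h3]; field_simp; ring
      linarith
    calc _ ≤ ∑ u ∈ I ∪ W.filter (fun u => 0 < c u), g u :=
          Finset.sum_le_sum_of_subset_of_nonneg hcover fun u _ _ => hg.nonneg u
      _ ≤ ∑ u ∈ I, g u + ∑ u ∈ W.filter (fun u => 0 < c u), g u := by
          rw [← Finset.sum_union_inter]
          exact le_add_of_nonneg_right (Finset.sum_nonneg fun u _ => hg.nonneg u)
      _ = ∑ v ∈ I, (g v + ∑ u ∈ nbrIn G W v, g u / c u) := by
          rw [Finset.sum_add_distrib, hdouble]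
      _ ≤ ∑ v ∈ I, 1 := Finset.sum_le_sum hlocal
      _ = I.card := by simp
  refine ⟨v, (hID v hvI).1, (hID v hvI).2, fun a ha b hb hab had hbd => ?_⟩
  by_contra hnadj
  obtain ⟨haW, hva⟩ := mem_nbrIn.1 ha
  obtain ⟨hbW, hvb⟩ := mem_nbrIn.1 hb
  have haI : a ∉ I := fun h => hIind hvI h hva.ne hva
  have hbI : b ∉ I := fun h => hIind hvI h hvb.ne hvb
  have hJ : insert a (insert b (I.erase v)) ∈ 𝒜 := by
    refine (hmem _).2 ⟨?_, ?_⟩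
    · intro u hu
      simp only [Finset.mem_insert, Finset.mem_erase] at hu
      rcases hu with rfl | rfl | hu
      · exact ⟨haW, had⟩
      · exact ⟨hbW, hbd⟩
      · exact hID u hu.2
    · have hap : ∀ z ∈ I, z ≠ v → ¬ G.Adj a z := fun z hz hzv h => hzv (hpriv a ha z hz h)
      have hbp : ∀ z ∈ I, z ≠ v → ¬ G.Adj b z := fun z hz hzv h => hzv (hpriv b hb z hz h)
      intro p hp q hq hpq hadj
      simp only [Finset.coe_insert, Finset.coe_erase, Set.mem_insert_iff, Set.mem_sdiff,
        Finset.mem_coe, Set.mem_singleton_iff] at hp hq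
      have hs := hadj.symm
      rcases hp with rfl | rfl | hp <;> rcases hq with rfl | rfl | hq
      · exact hpq rfl
      · exact hnadj hadj
      · exact hap q hq.1 hq.2 hadj
      · exact hnadj hs
      · exact hpq rfl
      · exact hbp q hq.1 hq.2 hadj
      · exact hap p hp.1 hp.2 hs
      · exact hbp p hp.1 hp.2 hs
      · exact hIind hp.1 hq.1 hpq hadj
  have hlt := hmax _ hJ
  rw [Finset.card_insert_of_notMem (by simp [hab, haI]),
    Finset.card_insert_of_notMem (by simp [hbI]), Finset.card_erase_add_one hvI] at hlt
  omega

/-- Excess bound for a neighbourhood with `k` vertices of minimum degree `δ`, one vertex of degree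
`d > δ`, and `c` further vertices of degree more than `δ`. -/
theorem excess_le_of_min_degree_nonadj {k c d δ D : ℕ} (hk : k + (c + 1) = δ + 1) (hd : δ + 1 ≤ d)
    (hD : D ≤ d + c) :
    (k : ℝ) * (2 / (2 * δ + 1)) + 2 / (2 * d + 1) + c * (2 / (2 * (δ + 1 : ℕ) + 1)) - 1 ≤
      1 / (2 * (D : ℝ) + 1) := by
  have hk' : (k : ℝ) = δ - c := by
    rw [eq_sub_iff_add_eq]; exact_mod_cast (by omega : k + c = δ)
  have hd' : (δ : ℝ) + 1 ≤ d := by exact_mod_cast hd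
  have hD' : (D : ℝ) ≤ d + c := by exact_mod_cast hD
  have hδ0 : (0 : ℝ) ≤ δ := Nat.cast_nonneg δ
  have hc0 : (0 : ℝ) ≤ c := Nat.cast_nonneg c
  have h1 : (1 : ℝ) / (2 * (d + c) + 1) ≤ 1 / (2 * D + 1) := by gcongr
  refine le_trans ?_ h1
  have h2 : (1 : ℝ) / (2 * d + 1) ≤ 1 / (2 * δ + 1) := by gcongr; linarith
  have h3 : (1 : ℝ) / (2 * d + 1) - 1 / (2 * (d + c) + 1) ≤
      4 * c / ((2 * δ + 1) * (2 * (δ + 1) + 1)) := by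
    have : (1 : ℝ) / (2 * d + 1) - 1 / (2 * (d + c) + 1) =
        2 * c / ((2 * d + 1) * (2 * (d + c) + 1)) := by
      field_simp; ring
    rw [this]
    have h4 : (2 * δ + 1) * (2 * ((δ : ℝ) + 1) + 1) ≤ (2 * d + 1) * (2 * (d + c) + 1) := by
      exact mul_le_mul (by linarith) (by linarith) (by linarith) (by linarith)
    have h5 : 2 * (c : ℝ) ≤ 4 * c := by linarith
    gcongr
  have h5 : ((δ : ℝ) - c) * (2 / (2 * δ + 1)) + c * (2 / (2 * (δ + 1) + 1)) - 1 =
      -(1 / (2 * δ + 1)) - 4 * c / ((2 * δ + 1) * (2 * (δ + 1) + 1)) := by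
    field_simp; ring
  have h6 : (2 : ℝ) / (2 * d + 1) = 1 / (2 * d + 1) + 1 / (2 * d + 1) := by ring
  push_cast
  rw [hk', h6]
  linarith

/-- Excess bound for a neighbourhood with `k` vertices of minimum degree `δ`, two vertices of
degrees `d, e > δ`, and `c` further vertices of degree more than `δ`. -/
theorem excess_le_of_complete_nonadj {k c d e δ D : ℕ} (hk : k + (c + 2) = δ + 1)
    (hd : δ + 1 ≤ d) (he : δ + 1 ≤ e) (hD : D + 2 * k ≤ d + e) :
    (k : ℝ) * (2 / (2 * δ + 1)) + 2 / (2 * d + 1) + 2 / (2 * e + 1) +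
      c * (2 / (2 * (δ + 1 : ℕ) + 1)) - 1 ≤ 1 / (2 * (D : ℝ) + 1) := by
  have hk' : (k : ℝ) = δ - 1 - c := by
    have : (k : ℝ) + c + 1 = δ := by exact_mod_cast (by omega : k + c + 1 = δ)
    linarith
  obtain ⟨x, rfl⟩ := Nat.exists_eq_add_of_le hd
  obtain ⟨y, rfl⟩ := Nat.exists_eq_add_of_le he
  have hD' : D ≤ x + y + 4 + 2 * c := by omega
  have h1 : (1 : ℝ) / (2 * (x + y + 4 + 2 * c : ℕ) + 1) ≤ 1 / (2 * D + 1) := by gcongr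
  refine le_trans ?_ h1
  push_cast
  rw [hk']
  have hδ0 : (0 : ℝ) ≤ δ := Nat.cast_nonneg δ
  have hc0 : (0 : ℝ) ≤ c := Nat.cast_nonneg c
  have hx0 : (0 : ℝ) ≤ x := Nat.cast_nonneg x
  have hy0 : (0 : ℝ) ≤ y := Nat.cast_nonneg y
  set p : ℝ := 2 * δ + 1 with hp
  set T : ℝ := 2 * x + 2 * y + 4 with hT
  have hp0 : 1 ≤ p := by linarith
  have hx : (2 : ℝ) / (2 * (δ + 1 + x) + 1) ≤ 2 / p - 4 * (x + 1) / (p * (p + T)) := by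
    have : (2 : ℝ) / (2 * (δ + 1 + x) + 1) = 2 / p - 4 * (x + 1) / (p * (p + (2 * x + 2))) := by
      rw [hp]; field_simp; ring
    have hle : 2 * (x : ℝ) + 2 ≤ T := by linarith
    rw [this]
    gcongr
  have hy : (2 : ℝ) / (2 * (δ + 1 + y) + 1) ≤ 2 / p - 4 * (y + 1) / (p * (p + T)) := by
    have : (2 : ℝ) / (2 * (δ + 1 + y) + 1) = 2 / p - 4 * (y + 1) / (p * (p + (2 * y + 2))) := by
      rw [hp]; field_simp; ring
    have hle : 2 * (y : ℝ) + 2 ≤ T := by linarith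
    rw [this]
    gcongr
  have hz : c * ((2 : ℝ) / (2 * (δ + 1) + 1)) ≤ c * (2 / p) - 4 * c / (p * (p + T)) := by
    have : c * ((2 : ℝ) / (2 * (δ + 1) + 1)) = c * (2 / p) - 4 * c / (p * (p + 2)) := by
      rw [hp]; field_simp; ring
    rw [this]
    gcongr
    linarith
  have hmain : 1 / p - (2 * T + 4 * c) / (p * (p + T)) ≤ 1 / (T + 4 * c + 5) := by
    have hT4 : 4 ≤ T := by linarith
    have : 1 / p - (2 * T + 4 * c) / (p * (p + T)) = (p - T - 4 * c) / (p * (p + T)) := by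
      field_simp; ring
    rw [this, div_le_div_iff₀ (by positivity) (by positivity)]
    nlinarith [sq_nonneg (p - (T + 4 * c)), mul_nonneg (by linarith : 0 ≤ p) hc0,
      mul_nonneg (by linarith : 0 ≤ p) (by linarith : 0 ≤ T - 4)]
  have hden : 2 * ((x : ℝ) + y + 4 + 2 * c) + 1 = T + 4 * c + 5 := by rw [hT]; ring
  have hsum : (2 * T + 4 * c) / (p * (p + T)) = 4 * (x + 1) / (p * (p + T)) +
      4 * (y + 1) / (p * (p + T)) + 4 * c / (p * (p + T)) := by
    rw [hT]; ring
  have hk2 : ((δ : ℝ) - 1 - c) * (2 / p) + 2 / p + 2 / p + c * (2 / p) - 1 = 1 / p := by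
    rw [hp]; field_simp; ring
  rw [hden]
  linarith

theorem IsDemand.hasLargeIndep {V : Type*} [DecidableEq V] (n : ℕ) :
    ∀ (G : SimpleGraph V) (W : Finset V) (g : V → ℝ), W.card = n → IsDemand G W g →
      HasLargeIndep G W g := by
  induction n using Nat.strong_induction_on with
  | _ n ihn =>
  intro G W g hn hg
  have ih : ∀ (G' : SimpleGraph V) (W' : Finset V) (g' : V → ℝ), W'.card < W.card →
      IsDemand G' W' g' → HasLargeIndep G' W' g' := fun G' W' g' h hg' =>
    ihn _ (hn ▸ h) G' W' g' rfl hg'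
  by_cases hsplit : ∃ I ⊆ W, I.Nonempty ∧ IsIndepSet G (I : Set V) ∧
      ∑ v ∈ I.biUnion (fun v => insert v (nbrIn G W v)), g v ≤ I.card
  · obtain ⟨I, hIW, ⟨a, ha⟩, hI, hle⟩ := hsplit
    refine HasLargeIndep.of_sdiff hIW hI hle (ih _ _ _ ?_ (hg.mono Finset.sdiff_subset))
    refine Finset.card_lt_card ⟨Finset.sdiff_subset, fun h => ?_⟩
    exact (Finset.mem_sdiff.1 (h (hIW ha))).2
      (Finset.mem_biUnion.2 ⟨a, ha, Finset.mem_insert_self _ _⟩)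
  push Not at hsplit
  rcases W.eq_empty_or_nonempty with rfl | hWne
  · exact ⟨∅, by simp, by simp [IsIndepSet], by simp⟩
  obtain ⟨w, hw, hwmin⟩ := W.exists_min_image (fun u => (nbrIn G W u).card) hWne
  obtain ⟨δ, hδ⟩ : ∃ δ, (nbrIn G W w).card = δ := ⟨_, rfl⟩
  rw [hδ] at hwmin
  obtain ⟨v, hvW, hvδ, hclq⟩ := exists_clique_of_min_degree hg hwmin ⟨w, hw, hδ⟩ hsplit
  set M := insert v (nbrIn G W v) with hM
  have hvN : v ∉ nbrIn G W v := fun h => (mem_nbrIn.1 h).2.ne rfl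
  have hMcard : M.card = δ + 1 := by rw [hM, Finset.card_insert_of_notMem hvN, hvδ]
  have hMsum : 1 < ∑ u ∈ M, g u := by
    have := hsplit {v} (by simpa using hvW) (by simp) (by simp [IsIndepSet])
    simpa using this
  have hMW : M ⊆ W := Finset.insert_subset hvW fun u hu => (mem_nbrIn.1 hu).1
  set K := M.filter (fun u => (nbrIn G W u).card = δ) with hK
  set X := M.filter (fun u => ¬ (nbrIn G W u).card = δ) with hX
  have hKX : K.card + X.card = δ + 1 := by
    rw [← hMcard]; exact Finset.card_filter_add_card_filter_not _
  have hsumKX : ∑ u ∈ M, g u = ∑ u ∈ K, g u + ∑ u ∈ X, g u :=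
    (Finset.sum_filter_add_sum_filter_not _ _ _).symm
  have hvK : v ∈ K := Finset.mem_filter.2 ⟨Finset.mem_insert_self _ _, hvδ⟩
  have hKM : ∀ u ∈ K, u ∈ M := fun u hu => (Finset.mem_filter.1 hu).1
  have hXM : ∀ u ∈ X, u ∈ M := fun u hu => (Finset.mem_filter.1 hu).1
  have hXdeg : ∀ u ∈ X, δ + 1 ≤ (nbrIn G W u).card := fun u hu => by
    have h1 := hwmin u (hMW (hXM u hu))
    have h2 := (Finset.mem_filter.1 hu).2
    omega
  have hXN : ∀ u ∈ X, u ∈ nbrIn G W v := fun u hu => by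
    rcases Finset.mem_insert.1 (hXM u hu) with rfl | h
    · exact absurd hvδ (Finset.mem_filter.1 hu).2
    · exact h
  have hKclq : ∀ a ∈ K, ∀ b ∈ K, a ≠ b → G.Adj a b := by
    intro a ha b hb hab
    obtain ⟨ha1, ha2⟩ := Finset.mem_filter.1 ha
    obtain ⟨hb1, hb2⟩ := Finset.mem_filter.1 hb
    rcases Finset.mem_insert.1 ha1 with rfl | ha1 <;> rcases Finset.mem_insert.1 hb1 with rfl | hb1
    · exact absurd rfl hab
    · exact (mem_nbrIn.1 hb1).2
    · exact (mem_nbrIn.1 ha1).2.symm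
    · exact hclq a ha1 b hb1 hab ha2 hb2
  have hKsum : ∑ u ∈ K, g u ≤ K.card * (2 / (2 * (δ : ℝ) + 1)) := by
    rw [← nsmul_eq_mul]
    refine Finset.sum_le_card_nsmul _ _ _ fun u hu => ?_
    exact (hg.le_degree u (hMW (hKM u hu))).trans (two_div_antitone (hwmin u (hMW (hKM u hu))))
  have hXsum : ∀ Y ⊆ X, ∑ u ∈ Y, g u ≤ Y.card * (2 / (2 * ((δ + 1 : ℕ) : ℝ) + 1)) := by
    intro Y hY
    rw [← nsmul_eq_mul]
    refine Finset.sum_le_card_nsmul _ _ _ fun u hu => ?_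
    exact (hg.le_degree u (hMW (hXM u (hY hu)))).trans (two_div_antitone (hXdeg u (hY hu)))
  have hsdiff : ∀ (u : V) (S : Finset V), S ⊆ M → (∀ z ∈ S, G.Adj u z) →
      (nbrIn G W u \ M).card + S.card ≤ (nbrIn G W u).card := by
    intro u S hS hadj
    rw [← Finset.card_union_of_disjoint]
    · refine Finset.card_le_card (Finset.union_subset Finset.sdiff_subset fun z hz => ?_)
      exact mem_nbrIn.2 ⟨hMW (hS hz), hadj z hz⟩
    · exact Finset.disjoint_left.2 fun z hz hz' => (Finset.mem_sdiff.1 hz).2 (hS hz')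
  by_cases hcase : ∃ x ∈ X, ∃ y ∈ K, ¬ G.Adj x y
  · obtain ⟨x, hx, y, hy, hxy⟩ := hcase
    have hvx := (mem_nbrIn.1 (hXN x hx)).2
    have hyv : y ≠ v := fun h => hxy (h ▸ hvx.symm)
    have hyN : y ∈ nbrIn G W v := (Finset.mem_insert.1 (hKM y hy)).resolve_left hyv
    have hne : x ≠ y := fun h => (Finset.mem_filter.1 hx).2 (h ▸ (Finset.mem_filter.1 hy).2)
    refine HasLargeIndep.of_joinNbrs hg ih hvW (hXN x hx) hyN hne hxy hMsum.le ?_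
    have h1 := hsdiff x {v} (by simp [hM]) (by simpa using hvx.symm)
    have h2 := hsdiff y (K.erase y) (fun z hz => hKM z (Finset.mem_of_mem_erase hz))
      (fun z hz => hKclq y hy z (Finset.mem_of_mem_erase hz) (Finset.ne_of_mem_erase hz).symm)
    rw [(Finset.mem_filter.1 hy).2] at h2
    rw [Finset.card_singleton] at h1
    have h3 := Finset.card_erase_add_one hy
    have h4 := Finset.card_erase_add_one hx
    have hb := excess_le_of_min_degree_nonadj (k := K.card) (c := (X.erase x).card)
      (d := (nbrIn G W x).card) (δ := δ)
      (D := (nbrIn G W x \ M).card + (nbrIn G W y \ M).card) (by omega) (hXdeg x hx) (by omega)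
    have h5 := hXsum (X.erase x) (Finset.erase_subset _ _)
    have h6 := hg.le_degree x (hMW (hXM x hx))
    have h7 := Finset.add_sum_erase X g hx
    rw [Nat.cast_add (nbrIn G W x \ M).card] at hb
    refine le_trans ?_ hb
    linarith
  push Not at hcase
  have hnclq : ∃ x ∈ X, ∃ y ∈ X, x ≠ y ∧ ¬ G.Adj x y := by
    by_contra! hcon
    refine absurd (hg.clique_le M hMW fun a ha b hb hab => ?_) (not_le.2 hMsum)
    by_cases haK : a ∈ K <;> by_cases hbK : b ∈ K
    · exact hKclq a haK b hbK hab
    · exact (hcase b (by grind) a haK).symm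
    · exact hcase a (by grind) b hbK
    · exact hcon a (by grind) b (by grind) hab
  obtain ⟨x, hx, y, hy, hne, hxy⟩ := hnclq
  refine HasLargeIndep.of_joinNbrs hg ih hvW (hXN x hx) (hXN y hy) hne hxy hMsum.le ?_
  have h1 := hsdiff x K hKM (hcase x hx)
  have h2 := hsdiff y K hKM (hcase y hy)
  have hy' : y ∈ X.erase x := Finset.mem_erase.2 ⟨hne.symm, hy⟩
  have h3 := Finset.card_erase_add_one hx
  have h4 := Finset.card_erase_add_one hy'
  have hb := excess_le_of_complete_nonadj (k := K.card) (c := ((X.erase x).erase y).card)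
    (d := (nbrIn G W x).card) (e := (nbrIn G W y).card) (δ := δ)
    (D := (nbrIn G W x \ M).card + (nbrIn G W y \ M).card) (by omega) (hXdeg x hx)
    (hXdeg y hy) (by omega)
  have h5 := hXsum ((X.erase x).erase y) fun z hz =>
    Finset.mem_of_mem_erase (Finset.mem_of_mem_erase hz)
  have h6 := hg.le_degree x (hMW (hXM x hx))
  have h7 := hg.le_degree y (hMW (hXM y hy))
  have h8 := Finset.add_sum_erase X g hx
  have h9 := Finset.add_sum_erase _ g hy'
  rw [Nat.cast_add (nbrIn G W x \ M).card] at hb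
  refine le_trans ?_ hb
  linarith

theorem card_le_indepNum {V : Type*} [Fintype V] {G : SimpleGraph V} {s : Finset V}
    (hs : IsIndepSet G (s : Set V)) : s.card ≤ indepNum G :=
  le_csSup ⟨Fintype.card V, by rintro n ⟨t, -, rfl⟩; exact Finset.card_le_univ t⟩ ⟨s, hs, rfl⟩

/-- Kelly–Postle. -/
theorem stmt1 {V : Type*} [Fintype V] (G : SimpleGraph V) [DecidableRel G.Adj]
    (g : V → ℝ)
    (hdeg : ∀ v : V, g v ≤ 2 / (2 * (G.degree v : ℝ) + 1))
    (hclique : ∀ K : Finset V, G.IsClique (K : Set V) → ∑ v ∈ K, g v ≤ 1) :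
    ∑ v : V, g v ≤ (indepNum G : ℝ) := by
  classical
  have hdem : IsDemand G Finset.univ (fun v => max (g v) 0) := by
    refine ⟨fun v => le_max_right _ _, fun v _ => max_le ?_ (by positivity), fun K _ hK => ?_⟩
    · have : nbrIn G Finset.univ v = G.neighborFinset v := by
        ext u; simp [mem_nbrIn]
      rw [this, G.card_neighborFinset_eq_degree]
      exact hdeg v
    · calc ∑ v ∈ K, max (g v) 0 = ∑ v ∈ K.filter (fun v => 0 ≤ g v), g v := by
            rw [Finset.sum_filter]
            refine Finset.sum_congr rfl fun v _ => ?_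
            split_ifs with h
            · exact max_eq_left h
            · exact max_eq_right (not_le.1 h).le
        _ ≤ 1 := hclique _ (hK.subset (by exact_mod_cast Finset.filter_subset _ _))
  obtain ⟨I, -, hI, hle⟩ := hdem.hasLargeIndep _ G _ _ rfl
  calc ∑ v, g v ≤ ∑ v, max (g v) 0 := Finset.sum_le_sum fun v _ => le_max_left _ _
    _ ≤ I.card := hle
    _ ≤ indepNum G := by exact_mod_cast card_le_indepNum hI
end

section
/- Let Δ ≥ 3 be an integer, let G be a finite connected simple graph with maximum degree Δ not isomorphic to K_{Δ+1}, and let real numbers c_1, …, c_Δ satisfy c_Δ = 1/Δ and i·c_i + c_{i+1} = 1 for i = 1, …, Δ−1. Then α(G) ≥ Σ_{i=1}^{Δ} c_i·|V_i(G)|. -/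
namespace BrooksWeight

open Finset

/-- `S` is nonempty and induces a connected subgraph: it has no proper nonempty subset that is
closed under adjacency in `S`. -/
def Conn {V : Type*} (G : SimpleGraph V) (S : Finset V) : Prop :=
  S.Nonempty ∧ ∀ T ⊆ S, T.Nonempty → (∀ a ∈ T, ∀ b ∈ S, G.Adj a b → b ∈ T) → T = S

theorem conn_univ {V : Type*} [Fintype V] {G : SimpleGraph V}
    (hconn : G.Connected) : Conn G univ := by
  have := hconn.nonempty
  refine ⟨univ_nonempty, fun T _ hT hcl => eq_univ_of_forall fun v => ?_⟩
  obtain ⟨u, hu⟩ := hT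
  obtain ⟨p⟩ := hconn.preconnected u v
  induction p with
  | nil => exact hu
  | cons h _ ih => exact ih (hcl _ hu _ (mem_univ _) h)

theorem isIndepSet_insert {V : Type*} [DecidableEq V] {G : SimpleGraph V} {I : Finset V}
    {y : V} (hI : IsIndepSet G (I : Set V)) (hy : ∀ i ∈ I, ¬ G.Adj i y) :
    IsIndepSet G ((insert y I : Finset V) : Set V) := by
  intro a ha b hb hab
  simp only [coe_insert, Set.mem_insert_iff, mem_coe] at ha hb
  rcases ha with rfl | ha <;> rcases hb with rfl | hb
  · exact absurd rfl hab
  · exact fun h => hy b hb h.symm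
  · exact hy a ha
  · exact hI ha hb hab

theorem card_le_indepNum {V : Type*} [Fintype V] {G : SimpleGraph V} {I : Finset V}
    (hI : IsIndepSet G (I : Set V)) : I.card ≤ indepNum G := by
  refine le_csSup ⟨Fintype.card V, ?_⟩ ⟨I, hI, rfl⟩
  rintro n ⟨s, -, rfl⟩
  exact card_le_univ s

variable {V : Type*} (G : SimpleGraph V) [DecidableRel G.Adj]

/-- The neighbours of `v` in `S`. -/
def nbr (S : Finset V) (v : V) : Finset V := S.filter (G.Adj v)

variable {G} in
theorem mem_nbr {S : Finset V} {v u : V} : u ∈ nbr G S v ↔ u ∈ S ∧ G.Adj v u := by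
  simp [nbr]

variable {G} in
theorem nbr_mono {S T : Finset V} (h : T ⊆ S) (v : V) : nbr G T v ⊆ nbr G S v :=
  filter_subset_filter _ h

variable [DecidableEq V]

/-- The closed neighbourhood of `I` in `S`. -/
def cl (S I : Finset V) : Finset V := S.filter fun u => u ∈ I ∨ ∃ i ∈ I, G.Adj i u

/-- The sets obtained from a vertex of `S` by repeatedly adding a vertex at distance two. -/
inductive Good (S : Finset V) : Finset V → Prop
  | single (v : V) : v ∈ S → Good S {v}
  | step (I : Finset V) (y z : V) :
      Good S I → y ∈ S → y ∉ cl G S I → z ∈ cl G S I → G.Adj z y → Good S (insert y I)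

variable {G} {S I : Finset V}

theorem mem_cl {u : V} : u ∈ cl G S I ↔ u ∈ S ∧ (u ∈ I ∨ ∃ i ∈ I, G.Adj i u) := by
  simp [cl]

theorem subset_cl (hI : I ⊆ S) : I ⊆ cl G S I :=
  fun _ hu => mem_cl.2 ⟨hI hu, Or.inl hu⟩

theorem cl_subset : cl G S I ⊆ S := filter_subset _ _

theorem mem_cl_singleton {u v : V} : u ∈ cl G S {v} ↔ u ∈ S ∧ (u = v ∨ G.Adj v u) := by
  simp [mem_cl]

theorem card_cl_singleton {v : V} (hv : v ∈ S) : (cl G S {v}).card = (nbr G S v).card + 1 := by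
  have h : cl G S {v} = insert v (nbr G S v) := by
    ext u
    simp only [mem_cl_singleton, mem_insert, mem_nbr]
    constructor
    · tauto
    · rintro (rfl | h) <;> tauto
  rw [h, card_insert_of_notMem (by simp [mem_nbr])]

theorem cl_insert (y : V) : cl G S (insert y I) = cl G S I ∪ cl G S {y} := by
  ext u
  simp only [mem_cl, mem_union, mem_insert, mem_singleton, exists_eq_or_imp, exists_eq_left]
  grind

theorem Good.subset (h : Good G S I) : I ⊆ S := by
  induction h with
  | single v hv => simpa using hv
  | step I y z _ hy _ _ _ ih => exact insert_subset hy ih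

theorem Good.nonempty (h : Good G S I) : I.Nonempty := by
  cases h <;> simp

theorem Good.indep (h : Good G S I) : IsIndepSet G (I : Set V) := by
  induction h with
  | single v hv => simp [IsIndepSet]
  | step I y z _ hy hyI _ _ ih =>
    exact isIndepSet_insert ih fun i hi h => hyI (mem_cl.2 ⟨hy, Or.inr ⟨i, hi, h⟩⟩)

/-- A connected set has an edge leaving every proper nonempty subset. -/
theorem Conn.exists_adj (hS : Conn G S) {T : Finset V} (hT : T ⊆ S) (hne : T.Nonempty)
    (h : T ≠ S) : ∃ a ∈ T, ∃ b ∈ S, b ∉ T ∧ G.Adj a b := by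
  by_contra! hcon
  exact h (hS.2 T hT hne fun a ha b hb hab => by
    by_contra hbT
    exact hcon a ha b hb hbT hab)

variable {d : ℕ}

theorem card_cl_insert_add (hreg : ∀ v ∈ S, (nbr G S v).card = d) {y : V} (hy : y ∈ S) :
    (cl G S (insert y I)).card + (cl G S I ∩ cl G S {y}).card = (cl G S I).card + d + 1 := by
  rw [cl_insert, card_union_add_card_inter, card_cl_singleton hy, hreg y hy, add_assoc]

theorem card_cl_insert_le (hreg : ∀ v ∈ S, (nbr G S v).card = d) {y z : V} (hy : y ∈ S)
    (hz : z ∈ cl G S I) (hzy : G.Adj z y) :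
    (cl G S (insert y I)).card ≤ (cl G S I).card + d := by
  have h := card_cl_insert_add (I := I) hreg hy
  have : 0 < (cl G S I ∩ cl G S {y}).card := card_pos.2
    ⟨z, mem_inter.2 ⟨hz, mem_cl_singleton.2 ⟨cl_subset hz, Or.inr hzy.symm⟩⟩⟩
  omega

theorem Good.card_cl_le (hreg : ∀ v ∈ S, (nbr G S v).card = d) (h : Good G S I) :
    (cl G S I).card ≤ d * I.card + 1 := by
  induction h with
  | single v hv => simp [card_cl_singleton hv, hreg v hv]
  | step I y z hI hy hyI hz hzy ih =>
    have h1 := card_cl_insert_le hreg hy hz hzy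
    rw [card_insert_of_notMem fun h => hyI (subset_cl hI.subset h), mul_add]
    omega

/-- Every good set extends to one dominating `S`. -/
theorem Good.exists_dominating (hreg : ∀ v ∈ S, (nbr G S v).card = d) (hS : Conn G S)
    (h : Good G S I) :
    ∃ J, Good G S J ∧ cl G S J = S ∧ S.card + d * I.card ≤ (cl G S I).card + d * J.card := by
  induction hn : S.card - I.card using Nat.strong_induction_on generalizing I with
  | _ n ih =>
  by_cases hc : cl G S I = S
  · exact ⟨I, h, hc, by rw [hc]⟩
  obtain ⟨z, hz, y, hy, hyI, hzy⟩ :=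
    hS.exists_adj cl_subset (h.nonempty.mono (subset_cl h.subset)) hc
  have hg := Good.step I y z h hy hyI hz hzy
  have hcard := card_insert_of_notMem fun h' => hyI (subset_cl h.subset h')
  have hle := card_le_card hg.subset
  obtain ⟨J, hJ, hJS, hJc⟩ := ih _ (by omega) hg rfl
  refine ⟨J, hJ, hJS, ?_⟩
  have h1 := card_cl_insert_le hreg hy hz hzy
  rw [hcard, mul_add] at hJc
  omega

theorem exists_indep_regular (hreg : ∀ v ∈ S, (nbr G S v).card = d) (hS : Conn G S) :
    ∃ I ⊆ S, IsIndepSet G (I : Set V) ∧ S.card ≤ d * I.card + 1 := by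
  obtain ⟨v, hv⟩ := hS.1
  obtain ⟨J, hJ, hJS, -⟩ := (Good.single (G := G) v hv).exists_dominating hreg hS
  exact ⟨J, hJ.subset, hJ.indep, by simpa only [hJS] using hJ.card_cl_le hreg⟩

variable (G S d) in
/-- `S` induces a connected `d`-regular graph all of whose independent sets are smaller than
`|S| / d`. -/
structure Deficient : Prop where
  conn : Conn G S
  reg : ∀ v ∈ S, (nbr G S v).card = d
  small : ∀ I ⊆ S, IsIndepSet G (I : Set V) → d * I.card < S.card

theorem Good.card_cl_eq (hD : Deficient G S d) (h : Good G S I) :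
    (cl G S I).card = d * I.card + 1 := by
  obtain ⟨J, hJ, -, hJc⟩ := h.exists_dominating hD.reg hD.conn
  have h1 := hD.small J hJ.subset hJ.indep
  have h2 := h.card_cl_le hD.reg
  omega

/-- A vertex outside the closed neighbourhood of a good set has at most one neighbour in it. -/
theorem Good.eq_of_adj (hD : Deficient G S d) (h : Good G S I) {y a b : V} (hy : y ∈ S)
    (hyI : y ∉ cl G S I) (ha : a ∈ cl G S I) (hb : b ∈ cl G S I) (hya : G.Adj y a)
    (hyb : G.Adj y b) : a = b := by
  by_contra hab
  have hg := (Good.step I y a h hy hyI ha hya.symm).card_cl_eq hD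
  rw [card_insert_of_notMem fun h' => hyI (subset_cl h.subset h'), mul_add] at hg
  have h1 := h.card_cl_eq hD
  have h2 := card_cl_insert_add (I := I) hD.reg hy
  have h3 : ({a, b} : Finset V).card ≤ (cl G S I ∩ cl G S {y}).card := by
    refine card_le_card fun u hu => ?_
    simp only [mem_insert, mem_singleton] at hu
    rcases hu with rfl | rfl
    · exact mem_inter.2 ⟨ha, mem_cl_singleton.2 ⟨cl_subset ha, Or.inr hya⟩⟩
    · exact mem_inter.2 ⟨hb, mem_cl_singleton.2 ⟨cl_subset hb, Or.inr hyb⟩⟩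
  rw [card_pair hab] at h3
  omega

/-- `R` is a clique on `d` vertices of `S`, each vertex `r` of which has exactly one neighbour
`p r` in `S` outside of `R`. -/
structure OuterClique (G : SimpleGraph V) (S R : Finset V) (d : ℕ) (p : V → V) : Prop where
  subset : R ⊆ S
  card : R.card = d
  adj : ∀ r ∈ R, ∀ s ∈ R, r ≠ s → G.Adj r s
  outer_mem : ∀ r ∈ R, p r ∈ S
  outer_notMem : ∀ r ∈ R, p r ∉ R
  adj_outer : ∀ r ∈ R, G.Adj r (p r)
  eq_outer : ∀ r ∈ R, ∀ z ∈ S, z ∉ R → G.Adj r z → z = p r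

/-- What a maximal non-dominating good set leaves over is a clique with outer neighbours. -/
theorem Deficient.exists_outerClique (hD : Deficient G S d) {a b : V} (ha : a ∈ S) (hb : b ∈ S)
    (hab : a ≠ b) (hadj : ¬ G.Adj a b) : ∃ R p, OuterClique G S R d p := by
  classical
  have hne : b ∉ cl G S {a} := fun h => (mem_cl_singleton.1 h).2.elim hab.symm hadj
  obtain ⟨I, hI, hImax⟩ := exists_max_image
    (S.powerset.filter fun I => Good G S I ∧ cl G S I ≠ S) card
    ⟨{a}, by
      simp only [mem_filter, mem_powerset, singleton_subset_iff]
      exact ⟨ha, Good.single a ha, fun h => hne (h.symm ▸ hb)⟩⟩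
  simp only [mem_filter, mem_powerset, and_imp] at hI hImax
  obtain ⟨-, hIg, hIS⟩ := hI
  obtain ⟨z, hz, y, hy, hyI, hzy⟩ :=
    hD.conn.exists_adj cl_subset (hIg.nonempty.mono (subset_cl hIg.subset)) hIS
  have hg := Good.step I y z hIg hy hyI hz hzy
  have hcard := card_insert_of_notMem fun h' => hyI (subset_cl hIg.subset h')
  have hgS : cl G S (insert y I) = S := by
    by_contra hne
    have := hImax _ hg.subset hg hne
    omega
  have hSc := hg.card_cl_eq hD
  rw [hgS, hcard, mul_add] at hSc
  have hIc := hIg.card_cl_eq hD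
  have hR : (S \ cl G S I).card = d := by
    rw [card_sdiff_of_subset cl_subset]
    omega
  have key : ∀ r ∈ S \ cl G S I, nbr G S r ∩ (S \ cl G S I) = (S \ cl G S I).erase r ∧
      (nbr G S r ∩ cl G S I).card = 1 := by
    intro r hr
    obtain ⟨hrS, hrI⟩ := mem_sdiff.1 hr
    have h1 : (nbr G S r ∩ cl G S I).card ≤ 1 := by
      rw [card_le_one]
      intro u hu v hv
      simp only [mem_inter, mem_nbr] at hu hv
      exact hIg.eq_of_adj hD hrS hrI hu.2 hv.2 hu.1.2 hv.1.2
    have h2 : nbr G S r ∩ (S \ cl G S I) ⊆ (S \ cl G S I).erase r := by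
      intro u hu
      simp only [mem_inter, mem_nbr] at hu
      exact mem_erase.2 ⟨hu.1.2.ne', hu.2⟩
    have h3 := card_erase_of_mem hr
    have h4 : (nbr G S r ∩ cl G S I).card + (nbr G S r ∩ (S \ cl G S I)).card = d := by
      rw [← hD.reg r hrS, ← card_inter_add_card_sdiff (nbr G S r) (cl G S I)]
      congr 2
      ext u
      simp only [mem_inter, mem_sdiff, mem_nbr]
      tauto
    have h5 := card_le_card h2
    have h6 : 0 < (S \ cl G S I).card := card_pos.2 ⟨r, hr⟩
    exact ⟨eq_of_subset_of_card_le h2 (by omega), by omega⟩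
  choose! p hp using fun r hr => card_eq_one.1 (key r hr).2
  have hpr : ∀ r ∈ S \ cl G S I, p r ∈ S ∧ G.Adj r (p r) ∧ p r ∈ cl G S I := by
    intro r hr
    have : p r ∈ nbr G S r ∩ cl G S I := by simp [hp r hr]
    simpa [mem_nbr, and_assoc] using this
  refine ⟨S \ cl G S I, p, sdiff_subset, hR, fun r hr s hs hrs => ?_, fun r hr => (hpr r hr).1,
    fun r hr h => (mem_sdiff.1 h).2 (hpr r hr).2.2, fun r hr => (hpr r hr).2.1,
    fun r hr z hz hzR hrz => ?_⟩
  · have : s ∈ nbr G S r ∩ (S \ cl G S I) := by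
      rw [(key r hr).1]
      exact mem_erase.2 ⟨hrs.symm, hs⟩
    exact (mem_nbr.1 (mem_inter.1 this).1).2
  · have hzI : z ∈ cl G S I := by
      by_contra hzI
      exact hzR (mem_sdiff.2 ⟨hz, hzI⟩)
    have : z ∈ nbr G S r ∩ cl G S I := mem_inter.2 ⟨mem_nbr.2 ⟨hz, hrz⟩, hzI⟩
    rwa [hp r hr, mem_singleton] at this

variable {R : Finset V} {p : V → V}

theorem OuterClique.outer_injOn (hR : OuterClique G S R d p) (hD : Deficient G S d) {a b : V}
    (ha : a ∈ S) (hb : b ∈ S) (hab : a ≠ b) (hadj : ¬ G.Adj a b) {r s : V} (hr : r ∈ R)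
    (hs : s ∈ R) (hpp : p r = p s) : r = s := by
  by_contra hrs
  by_cases hall : ∀ t ∈ R, p t = p r
  · have hins : insert (p r) R = S := by
      by_contra hne
      obtain ⟨u, hu, v, hv, hvR, huv⟩ := hD.conn.exists_adj
        (insert_subset (hR.outer_mem r hr) hR.subset) (insert_nonempty _ _) hne
      have hnb : R ⊆ nbr G S (p r) := fun t ht =>
        mem_nbr.2 ⟨hR.subset ht, by simpa [hall t ht] using (hR.adj_outer t ht).symm⟩
      rw [mem_insert, not_or] at hvR
      rcases mem_insert.1 hu with rfl | hu
      · have h1 : R = nbr G S (p r) := eq_of_subset_of_card_le hnb (by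
          rw [hD.reg _ (hR.outer_mem r hr), hR.card])
        exact hvR.2 (h1 ▸ mem_nbr.2 ⟨hv, huv⟩)
      · exact hvR.1 ((hR.eq_outer u hu v hv hvR.2 huv).trans (hall u hu))
    rw [← hins, mem_insert] at ha hb
    rcases ha with rfl | ha <;> rcases hb with rfl | hb
    · exact hab rfl
    · exact hadj (by simpa [hall b hb] using (hR.adj_outer b hb).symm)
    · exact hadj (by simpa [hall a ha] using hR.adj_outer a ha)
    · exact hadj (hR.adj a ha b hb hab)
  · push Not at hall
    obtain ⟨t, ht, htr⟩ := hall
    have hmem : ∀ u ∈ R, u ∈ cl G S {t} := by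
      intro u hu
      refine mem_cl_singleton.2 ⟨hR.subset hu, ?_⟩
      by_cases h : u = t
      · exact Or.inl h
      · exact Or.inr (hR.adj t ht u hu (Ne.symm h))
    refine hrs ((Good.single t (hR.subset ht)).eq_of_adj hD (hR.outer_mem r hr) ?_ (hmem r hr)
      (hmem s hs) (hR.adj_outer r hr).symm (hpp ▸ (hR.adj_outer s hs).symm))
    rw [mem_cl_singleton]
    rintro ⟨-, h | h⟩
    · exact hR.outer_notMem r hr (h ▸ ht)
    · exact htr (hR.eq_outer t ht _ (hR.outer_mem r hr) (hR.outer_notMem r hr) h).symm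

theorem OuterClique.notMem_cl (hR : OuterClique G S R d p) (hIS : I ⊆ S) (hI : Disjoint I R)
    {s : V} (hs : s ∈ R) (hps : p s ∉ I) : s ∉ cl G S I := by
  intro h
  rcases (mem_cl.1 h).2 with h | ⟨i, hi, his⟩
  · exact disjoint_left.1 hI h hs
  · exact hps (hR.eq_outer s hs i (hIS hi) (disjoint_left.1 hI hi) his.symm ▸ hi)

theorem OuterClique.mem_cl_of_outer_mem (hR : OuterClique G S R d p) {s : V} (hs : s ∈ R)
    (hps : p s ∈ I) : s ∈ cl G S I :=
  mem_cl.2 ⟨hR.subset hs, Or.inr ⟨p s, hps, (hR.adj_outer s hs).symm⟩⟩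

/-- A good set avoiding `R` and containing the outer neighbour of `r` dominates the outer
neighbour of no other vertex of `R` unless it contains it. -/
theorem OuterClique.outer_notMem_cl (hR : OuterClique G S R d p) (hD : Deficient G S d)
    (hg : Good G S I) (hI : Disjoint I R) {r s : V} (hr : r ∈ R) (hs : s ∈ R) (hsr : s ≠ r)
    (hpr : p r ∈ I) (hps : p s ∉ I) : p s ∉ cl G S I := by
  intro h
  have := hg.eq_of_adj hD (hR.subset hs) (hR.notMem_cl hg.subset hI hs hps)
    (hR.mem_cl_of_outer_mem hr hpr) h (hR.adj s hs r hr hsr) (hR.adj_outer s hs)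
  exact hR.outer_notMem s hs (this ▸ hr)

/-- The component of `S \ R` that contains `p r`. -/
theorem OuterClique.exists_branch (hR : OuterClique G S R d p) (hD : Deficient G S d)
    (hd : 3 ≤ d) (hinj : ∀ r ∈ R, ∀ s ∈ R, p r = p s → r = s) {r : V} (hr : r ∈ R) :
    ∃ D ⊆ S, p r ∈ D ∧ Disjoint D R ∧ (∀ u ∈ D, ∀ y ∈ S, y ∉ R → G.Adj u y → y ∈ D) ∧
      (∀ s ∈ R, s ≠ r → p s ∉ D) ∧ d ∣ D.card := by
  classical
  obtain ⟨I, hI, hImax⟩ := exists_max_image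
    (S.powerset.filter fun I => Good G S I ∧ p r ∈ I ∧ Disjoint I R ∧
      ∀ s ∈ R, s ≠ r → p s ∉ cl G S I) Finset.card
    ⟨{p r}, by
      have h1 : Good G S {p r} := Good.single _ (hR.outer_mem r hr)
      have h2 : Disjoint {p r} R := disjoint_singleton_left.2 (hR.outer_notMem r hr)
      simp only [mem_filter, mem_powerset]
      refine ⟨h1.subset, h1, mem_singleton_self _, h2, fun s hs hsr => ?_⟩
      exact hR.outer_notMem_cl hD h1 h2 hr hs hsr (mem_singleton_self _)
        fun h => hsr (hinj s hs r hr (mem_singleton.1 h))⟩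
  simp only [mem_filter, mem_powerset, and_imp] at hI hImax
  obtain ⟨hIS, hg, hpr, hIR, hIp⟩ := hI
  have hpI : ∀ s ∈ R, s ≠ r → p s ∉ I := fun s hs hsr h => hIp s hs hsr (subset_cl hIS h)
  have hrI := hR.mem_cl_of_outer_mem hr hpr
  refine ⟨(cl G S I).erase r, (erase_subset _ _).trans cl_subset, mem_erase.2
    ⟨fun h => hR.outer_notMem r hr (h.symm ▸ hr), subset_cl hIS hpr⟩, ?_, ?_, ?_, ?_⟩
  · refine disjoint_left.2 fun s hs hsR => ?_
    obtain ⟨hsr, hsI⟩ := mem_erase.1 hs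
    exact hR.notMem_cl hIS hIR hsR (hpI s hsR hsr) hsI
  · intro u hu y hy hyR huy
    refine mem_erase.2 ⟨fun h => hyR (h ▸ hr), ?_⟩
    by_contra hyI
    have hg' := Good.step I y u hg hy hyI (mem_of_mem_erase hu) huy
    have hcard := card_insert_of_notMem fun h' => hyI (subset_cl hIS h')
    have hIR' : Disjoint (insert y I) R := disjoint_insert_left.2 ⟨hyR, hIR⟩
    have hpr' : p r ∈ insert y I := mem_insert_of_mem hpr
    have hle := hImax _ hg'.subset hg' hpr' hIR' fun s hs hsr => by
      refine hR.outer_notMem_cl hD hg' hIR' hr hs hsr hpr' fun hps => ?_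
      obtain ⟨t, ht, hts⟩ : ∃ t ∈ R, t ∉ ({r, s} : Finset V) := by
        refine exists_mem_notMem_of_card_lt_card ?_
        rw [hR.card]
        exact card_le_two.trans_lt hd
      simp only [mem_insert, mem_singleton, not_or] at hts
      have hsy : p s = y := (mem_insert.1 hps).resolve_right (hpI s hs hsr)
      have hpt : p t ∉ insert y I := by
        rw [mem_insert, not_or]
        exact ⟨fun h => hts.2 (hinj t ht s hs (h.trans hsy.symm)), hpI t ht hts.1⟩
      exact hsr (hg'.eq_of_adj hD (hR.subset ht) (hR.notMem_cl hg'.subset hIR' ht hpt)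
        (hR.mem_cl_of_outer_mem hs hps) (hR.mem_cl_of_outer_mem hr hpr')
        (hR.adj t ht s hs hts.2) (hR.adj t ht r hr hts.1))
    omega
  · exact fun s hs hsr h => hIp s hs hsr (mem_of_mem_erase h)
  · rw [card_erase_of_mem hrI, hg.card_cl_eq hD]
    simp

/-- The independence number version of Brooks' theorem for regular graphs. -/
theorem exists_indep_brooks (hd : 3 ≤ d) (hreg : ∀ v ∈ S, (nbr G S v).card = d)
    (hS : Conn G S) {a b : V} (ha : a ∈ S) (hb : b ∈ S) (hab : a ≠ b) (hadj : ¬ G.Adj a b) :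
    ∃ I ⊆ S, IsIndepSet G (I : Set V) ∧ S.card ≤ d * I.card := by
  by_contra! hsmall
  have hD : Deficient G S d := ⟨hS, hreg, hsmall⟩
  obtain ⟨R, p, hR⟩ := hD.exists_outerClique ha hb hab hadj
  have hinj : ∀ r ∈ R, ∀ s ∈ R, p r = p s → r = s := fun r hr s hs h =>
    hR.outer_injOn hD ha hb hab hadj hr hs h
  choose! D hDS hpD hDR hDcl hpD' hdvd using
    fun r (hr : r ∈ R) => hR.exists_branch hD hd hinj hr
  have hdisj : ∀ r ∈ R, ∀ s ∈ R, r ≠ s → Disjoint (D r) (D s) := by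
    intro r hr s hs hrs
    rw [disjoint_iff_inter_eq_empty, ← not_nonempty_iff_eq_empty]
    intro hne
    have := hS.2 (D r ∩ D s) (inter_subset_left.trans (hDS r hr)) hne fun u hu y hy huy => by
      obtain ⟨hur, hus⟩ := mem_inter.1 hu
      by_cases hyR : y ∈ R
      · exfalso
        have hup := hR.eq_outer y hyR u (hDS r hr hur) (disjoint_left.1 (hDR r hr) hur) huy.symm
        by_cases hyr : y = r
        · exact hpD' s hs y hyR (hyr ▸ hrs) (hup ▸ hus)
        · exact hpD' r hr y hyR hyr (hup ▸ hur)
      · exact mem_inter.2 ⟨hDcl r hr u hur y hy hyR huy, hDcl s hs u hus y hy hyR huy⟩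
    have hmem : p r ∈ D r ∩ D s := this ▸ hR.outer_mem r hr
    exact hpD' s hs r hr hrs (mem_inter.1 hmem).2
  have hunion : R ∪ R.biUnion D = S := by
    refine hS.2 _ (union_subset hR.subset (biUnion_subset.2 hDS)) ?_ fun u hu y hy huy => ?_
    · exact (card_pos.1 (by rw [hR.card]; omega)).mono subset_union_left
    by_cases hyR : y ∈ R
    · exact mem_union_left _ hyR
    refine mem_union_right _ (mem_biUnion.2 ?_)
    rcases mem_union.1 hu with hu | hu
    · exact ⟨u, hu, hR.eq_outer u hu y hy hyR huy ▸ hpD u hu⟩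
    · obtain ⟨r, hr, hur⟩ := mem_biUnion.1 hu
      exact ⟨r, hr, hDcl r hr u hur y hy hyR huy⟩
  have hcard : S.card = d + ∑ r ∈ R, (D r).card := by
    rw [← hunion, card_union_of_disjoint, card_biUnion hdisj, hR.card]
    exact (disjoint_biUnion_right _ _ _).2 fun r hr => (hDR r hr).symm
  have hdS : d ∣ S.card := hcard ▸ (dvd_refl d).add (dvd_sum hdvd)
  obtain ⟨J, hJS, hJ, hle⟩ := exists_indep_regular hreg hS
  have heq : S.card = d * J.card + 1 := le_antisymm hle (hsmall J hJS hJ)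
  rw [heq, Nat.dvd_add_right (dvd_mul_right _ _), Nat.dvd_one] at hdS
  omega

/-- If `w` is dominated by an independent set on every connected closed part of `X`, then also
on `X` itself. -/
theorem exists_indep_of_components (w : V → ℝ) (X : Finset V)
    (h : ∀ C ⊆ X, Conn G C → (∀ a ∈ C, ∀ b ∈ X, G.Adj a b → b ∈ C) →
      ∃ I ⊆ C, IsIndepSet G (I : Set V) ∧ ∑ v ∈ C, w v ≤ I.card) :
    ∃ I ⊆ X, IsIndepSet G (I : Set V) ∧ ∑ v ∈ X, w v ≤ I.card := by
  classical
  induction X using Finset.strongInduction with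
  | _ X ih =>
  rcases X.eq_empty_or_nonempty with rfl | hX
  · exact ⟨∅, subset_rfl, by simp [IsIndepSet], by simp⟩
  obtain ⟨T, hT, hTmin⟩ := exists_min_image
    (X.powerset.filter fun T => T.Nonempty ∧ ∀ a ∈ T, ∀ b ∈ X, G.Adj a b → b ∈ T) card
    ⟨X, by simpa using ⟨hX, fun _ _ _ hb _ => hb⟩⟩
  simp only [mem_filter, mem_powerset, and_imp] at hT hTmin
  obtain ⟨hTX, hTne, hTcl⟩ := hT
  have hconn : Conn G T := ⟨hTne, fun U hUT hU hUcl => eq_of_subset_of_card_le hUT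
    (hTmin U (hUT.trans hTX) hU fun a ha b hb hab => hUcl a ha b (hTcl a (hUT ha) b hb hab) hab)⟩
  obtain ⟨I, hIT, hI, hIw⟩ := h T hTX hconn hTcl
  obtain ⟨J, hJT, hJ, hJw⟩ := ih (X \ T) (sdiff_ssubset hTX hTne) fun C hC hCc hCcl =>
    h C (hC.trans sdiff_subset) hCc fun a ha b hb hab => by
      refine hCcl a ha b (mem_sdiff.2 ⟨hb, fun hbT => ?_⟩) hab
      exact (mem_sdiff.1 (hC ha)).2 (hTcl b hbT a (mem_sdiff.1 (hC ha)).1 hab.symm)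
  have hdisj : Disjoint I J := disjoint_of_subset_left hIT
    (disjoint_of_subset_right hJT disjoint_sdiff)
  refine ⟨I ∪ J, union_subset (hIT.trans hTX) (hJT.trans sdiff_subset), ?_, ?_⟩
  · have hcross : ∀ a ∈ I, ∀ b ∈ J, ¬ G.Adj a b := fun a ha b hb hab =>
      (mem_sdiff.1 (hJT hb)).2 (hTcl a (hIT ha) b (mem_sdiff.1 (hJT hb)).1 hab)
    intro a ha b hb hab
    simp only [coe_union, Set.mem_union, mem_coe] at ha hb
    rcases ha with ha | ha <;> rcases hb with hb | hb
    · exact hI ha hb hab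
    · exact hcross a ha b hb
    · exact fun h => hcross b hb a ha h.symm
    · exact hJ ha hb hab
  · rw [card_union_of_disjoint hdisj, ← sum_sdiff hTX]
    push_cast
    linarith

/-- The defining properties of the coefficients, extended to degree zero. -/
structure IsWeight (Δ : ℕ) (c : ℕ → ℝ) : Prop where
  zero : c 0 = 1
  top : c Δ = 1 / (Δ : ℝ)
  step : ∀ i < Δ, 1 ≤ i → (i : ℝ) * c i + c (i + 1) = 1

variable {Δ : ℕ} {c : ℕ → ℝ}

theorem IsWeight.bounds (hc : IsWeight Δ c) {i : ℕ} (hi : 1 ≤ i) (hiΔ : i ≤ Δ) :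
    1 / ((i : ℝ) + 1) ≤ c i ∧ c i ≤ 1 / (i : ℝ) := by
  have h0 : (0 : ℝ) < i := by exact_mod_cast hi
  induction hiΔ using Nat.decreasingInduction with
  | self =>
    rw [hc.top]
    exact ⟨one_div_le_one_div_of_le h0 (by linarith), le_rfl⟩
  | of_succ k hk ih =>
    have hrec := hc.step k hk hi
    obtain ⟨h1, h2⟩ := ih (by omega) (by positivity)
    push_cast at h1 h2
    have h3 : 0 ≤ c (k + 1) := le_trans (by positivity) h1
    constructor
    · rw [div_le_iff₀ (by positivity)]
      rw [le_div_iff₀ (by positivity)] at h2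
      have : (k : ℝ) * 1 ≤ k * (c k * (k + 1)) := by nlinarith
      exact le_of_mul_le_mul_left this h0
    · rw [le_div_iff₀ h0]
      linarith

theorem IsWeight.nonneg (hc : IsWeight Δ c) {i : ℕ} (hiΔ : i ≤ Δ) : 0 ≤ c i := by
  rcases Nat.eq_zero_or_pos i with rfl | hi
  · rw [hc.zero]
    exact zero_le_one
  · exact le_trans (by positivity) (hc.bounds hi hiΔ).1

theorem IsWeight.antitone (hc : IsWeight Δ c) {i j : ℕ} (hij : i ≤ j) (hj : j ≤ Δ) :
    c j ≤ c i := by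
  induction j, hij using Nat.le_induction with
  | base => exact le_rfl
  | succ k hik ih =>
    refine le_trans ?_ (ih (by omega))
    have h1 := (hc.bounds (i := k + 1) (by omega) hj).2
    rcases Nat.eq_zero_or_pos k with rfl | hk
    · simpa [hc.zero] using h1
    · refine h1.trans ?_
      push_cast
      exact (hc.bounds hk (by omega)).1

theorem IsWeight.mul_add_le (hc : IsWeight Δ c) {i : ℕ} (hi : i < Δ) :
    (i : ℝ) * c i + c (i + 1) ≤ 1 := by
  rcases Nat.eq_zero_or_pos i with rfl | h
  · have := hc.antitone (Nat.zero_le 1) hi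
    simpa [hc.zero] using this
  · exact (hc.step i hi h).le

/-- `k + 1` vertices of degree at least `k`, one of which has larger degree, have total weight
at most one. -/
theorem IsWeight.sum_le_one (hc : IsWeight Δ c) {A : Finset V} {f : V → ℕ} {k : ℕ}
    (hA : A.card = k + 1) (hk : ∀ v ∈ A, k ≤ f v) (hΔ : ∀ v ∈ A, f v ≤ Δ) {u : V} (hu : u ∈ A)
    (hku : k < f u) : ∑ v ∈ A, c (f v) ≤ 1 := by
  have hkΔ := hΔ u hu
  rw [← add_sum_erase _ _ hu]
  have h1 : c (f u) ≤ c (k + 1) := hc.antitone hku hkΔ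
  have h2 : ∑ v ∈ A.erase u, c (f v) ≤ (A.erase u).card • c k := sum_le_card_nsmul _ _ _
    fun v hv => hc.antitone (hk v (mem_of_mem_erase hv)) (hΔ v (mem_of_mem_erase hv))
  rw [card_erase_of_mem hu, hA, nsmul_eq_mul] at h2
  have := hc.mul_add_le (i := k) (by omega)
  simp only [Nat.add_sub_cancel] at h2
  linarith

theorem exists_indep_of_regular (hΔ : 3 ≤ Δ) (hc : IsWeight Δ c) (hS : Conn G S)
    {a b : V} (ha : a ∈ S) (hb : b ∈ S) (hab : a ≠ b) (hadj : ¬ G.Adj a b)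
    (hdΔ : d ≤ Δ) (hreg : ∀ v ∈ S, (nbr G S v).card = d) :
    ∃ I ⊆ S, IsIndepSet G (I : Set V) ∧ (S.card : ℝ) * c d ≤ I.card := by
  have hcard : d + 2 ≤ S.card := by
    rw [← hreg a ha]
    have h1 : insert a (insert b (nbr G S a)) ⊆ S :=
      insert_subset ha (insert_subset hb (filter_subset _ _))
    have h2 := card_le_card h1
    rwa [card_insert_of_notMem (by simp [mem_nbr, hab]),
      card_insert_of_notMem (by simp [mem_nbr, hadj])] at h2
  have hd : 1 ≤ d := by
    obtain ⟨u, hu, v, hv, -, huv⟩ := hS.exists_adj (singleton_subset_iff.2 ha)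
      (singleton_nonempty a) fun h => by simp [← h] at hcard
    rw [← hreg u (by simp_all)]
    exact card_pos.2 ⟨v, mem_nbr.2 ⟨hv, huv⟩⟩
  have hd0 : (0 : ℝ) < d := by exact_mod_cast hd
  rcases hdΔ.eq_or_lt with rfl | hlt
  · obtain ⟨I, hIS, hI, hle⟩ := exists_indep_brooks hΔ hreg hS ha hb hab hadj
    refine ⟨I, hIS, hI, ?_⟩
    rw [hc.top, mul_one_div, div_le_iff₀ hd0, mul_comm]
    exact_mod_cast hle
  · obtain ⟨I, hIS, hI, hle⟩ := exists_indep_regular hreg hS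
    refine ⟨I, hIS, hI, ?_⟩
    have h1 := hc.step d hlt hd
    have h2 := (hc.bounds (i := d + 1) (by omega) hlt).1
    have h3 : (S.card : ℝ) ≤ d * I.card + 1 := by exact_mod_cast hle
    have h4 : ((d + 1 : ℕ) : ℝ) + 1 ≤ S.card := by exact_mod_cast hcard
    rw [div_le_iff₀ (by positivity)] at h2
    have h6 := mul_le_mul_of_nonneg_left h4 (hc.nonneg hlt)
    have h7 : (d : ℝ) * (S.card * c d) = S.card - c (d + 1) * S.card := by
      rw [show c (d + 1) = 1 - d * c d by linarith]
      ring
    refine le_of_mul_le_mul_left ?_ hd0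
    rw [h7]
    linarith

/-- The weighted bound for every connected noncomplete induced subgraph. -/
theorem exists_indep_weight (hΔ : 3 ≤ Δ) (hc : IsWeight Δ c) (S : Finset V) (hS : Conn G S)
    {a b : V} (ha : a ∈ S) (hb : b ∈ S) (hab : a ≠ b) (hadj : ¬ G.Adj a b)
    (hdeg : ∀ v ∈ S, (nbr G S v).card ≤ Δ) :
    ∃ I ⊆ S, IsIndepSet G (I : Set V) ∧ ∑ v ∈ S, c (nbr G S v).card ≤ I.card := by
  induction S using Finset.strongInduction generalizing a b with
  | _ S ih =>
  obtain ⟨m, hm, hmin⟩ := exists_min_image S (fun v => (nbr G S v).card) hS.1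
  obtain ⟨k, hk⟩ : ∃ k, (nbr G S m).card = k := ⟨_, rfl⟩
  rw [hk] at hmin
  by_cases hreg : ∀ v ∈ S, (nbr G S v).card = k
  · obtain ⟨I, hIS, hI, hle⟩ :=
      exists_indep_of_regular hΔ hc hS ha hb hab hadj (hk ▸ hdeg m hm) hreg
    refine ⟨I, hIS, hI, ?_⟩
    rwa [sum_congr rfl fun v hv => by rw [hreg v hv], sum_const, nsmul_eq_mul]
  have hT : S.filter (fun v => (nbr G S v).card = k) ≠ S := fun h =>
    hreg (filter_eq_self.1 h)
  obtain ⟨v, hv, u, hu, huT, hvu⟩ := hS.exists_adj (filter_subset _ _)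
    ⟨m, mem_filter.2 ⟨hm, hk⟩⟩ hT
  obtain ⟨hvS, hvk⟩ := mem_filter.1 hv
  have hku : k < (nbr G S u).card := lt_of_le_of_ne (hmin u hu) fun h =>
    huT (mem_filter.2 ⟨hu, h.symm⟩)
  have hN : ∑ x ∈ cl G S {v}, c (nbr G S x).card ≤ 1 :=
    hc.sum_le_one (k := k) (by rw [card_cl_singleton hvS, hvk])
      (fun x hx => hmin x (cl_subset hx)) (fun x hx => hdeg x (cl_subset hx))
      (mem_cl_singleton.2 ⟨hu, Or.inr hvu⟩) hku
  have hvcl : v ∈ cl G S {v} := mem_cl_singleton.2 ⟨hvS, Or.inl rfl⟩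
  obtain ⟨J, hJX, hJ, hJw⟩ := exists_indep_of_components (G := G)
    (fun x => c (nbr G S x).card) (S \ cl G S {v}) (by
      intro C hC hCc _
      have hCS : C ⊆ S := hC.trans sdiff_subset
      have hne : C ≠ S := fun h => (mem_sdiff.1 (hC (h.symm ▸ hvS))).2 hvcl
      by_cases hcomp : ∀ x ∈ C, ∀ y ∈ C, x ≠ y → G.Adj x y
      · obtain ⟨x, hx, y, hy, hyC, hxy⟩ := hS.exists_adj hCS hCc.1 hne
        have herase : ∀ z ∈ C, C.erase z ⊆ nbr G S z := fun z hz t ht => mem_nbr.2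
          ⟨hCS (mem_of_mem_erase ht), hcomp z hz t (mem_of_mem_erase ht) (ne_of_mem_erase ht).symm⟩
        refine ⟨{x}, singleton_subset_iff.2 hx, by simp [IsIndepSet], ?_⟩
        rw [card_singleton, Nat.cast_one]
        have hpos : 0 < C.card := card_pos.2 ⟨x, hx⟩
        refine hc.sum_le_one (k := C.card - 1) (by omega) (fun z hz => ?_)
          (fun z hz => hdeg z (hCS hz)) hx ?_
        · rw [← card_erase_of_mem hz]
          exact card_le_card (herase z hz)
        · rw [← card_erase_of_mem hx]
          exact card_lt_card ⟨herase x hx, fun h =>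
            hyC (mem_of_mem_erase (h (mem_nbr.2 ⟨hy, hxy⟩)))⟩
      · push Not at hcomp
        obtain ⟨x, hx, y, hy, hxy, hnadj⟩ := hcomp
        obtain ⟨I, hIC, hI, hle⟩ := ih C (hCS.ssubset_of_ne hne) hCc hx hy hxy hnadj
          fun z hz => (card_le_card (nbr_mono hCS z)).trans (hdeg z (hCS hz))
        exact ⟨I, hIC, hI, (sum_le_sum fun z hz =>
          hc.antitone (card_le_card (nbr_mono hCS z)) (hdeg z (hCS hz))).trans hle⟩)
  have hvJ : ∀ i ∈ J, i ∉ cl G S {v} := fun i hi => (mem_sdiff.1 (hJX hi)).2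
  refine ⟨insert v J, insert_subset hvS (hJX.trans sdiff_subset),
    isIndepSet_insert hJ fun i hi hiv => hvJ i hi (mem_cl_singleton.2
      ⟨(mem_sdiff.1 (hJX hi)).1, Or.inr hiv.symm⟩), ?_⟩
  rw [card_insert_of_notMem fun h => hvJ v h hvcl,
    ← sum_sdiff (cl_subset : cl G S {v} ⊆ S)]
  push_cast
  linarith

theorem exists_not_adj [Fintype V] [Nonempty V] (hmax : G.maxDegree = Δ)
    (hnotK : ¬ Nonempty (G ≃g (⊤ : SimpleGraph (Fin (Δ + 1))))) :
    ∃ a b : V, a ≠ b ∧ ¬ G.Adj a b := by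
  by_contra! h
  obtain ⟨v, hv⟩ := G.exists_maximal_degree_vertex
  have hdeg : G.degree v = Fintype.card V - 1 := by
    rw [← G.card_neighborFinset_eq_degree, ← card_univ, ← card_erase_of_mem (mem_univ v)]
    congr 1
    ext u
    simp only [SimpleGraph.mem_neighborFinset, mem_erase, mem_univ, and_true]
    exact ⟨fun h => h.ne', fun hu => h v u hu.symm⟩
  have hpos : 0 < Fintype.card V := Fintype.card_pos
  have hcard : Fintype.card V = Δ + 1 := by omega
  refine hnotK ⟨⟨Fintype.equivFinOfCardEq hcard, fun {x y} => ?_⟩⟩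
  simp only [SimpleGraph.top_adj, ne_eq, EmbeddingLike.apply_eq_iff_eq]
  exact ⟨h x y, fun h => h.ne⟩

end BrooksWeight

theorem stmt3 (Δ : ℕ) (hΔ : 3 ≤ Δ) {V : Type*} [Fintype V]
    (G : SimpleGraph V) [DecidableRel G.Adj]
    (hconn : G.Connected) (hmax : G.maxDegree = Δ)
    (hnotK : ¬ Nonempty (G ≃g (⊤ : SimpleGraph (Fin (Δ + 1)))))
    (c : ℕ → ℝ) (hcΔ : c Δ = 1 / (Δ : ℝ))
    (hrec : ∀ i : ℕ, 1 ≤ i → i ≤ Δ - 1 → (i : ℝ) * c i + c (i + 1) = 1) :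
    ∑ i ∈ Finset.Icc 1 Δ,
      c i * ((Finset.univ.filter fun v : V => G.degree v = i).card : ℝ)
      ≤ (indepNum G : ℝ) := by
  classical
  have := hconn.nonempty
  have hw : BrooksWeight.IsWeight Δ (Function.update c 0 1) := by
    refine ⟨by simp, ?_, fun i hi h1 => ?_⟩
    · rw [Function.update_of_ne (by omega), hcΔ]
    · rw [Function.update_of_ne (by omega), Function.update_of_ne (by omega)]
      exact hrec i h1 (by omega)
  obtain ⟨a, b, hab, hadj⟩ := BrooksWeight.exists_not_adj hmax hnotK
  have hdeg : ∀ v, (BrooksWeight.nbr G Finset.univ v).card = G.degree v := fun v => by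
    rw [← G.card_neighborFinset_eq_degree, G.neighborFinset_eq_filter, BrooksWeight.nbr]
  have hle : ∀ v, G.degree v ≤ Δ := fun v => hmax ▸ G.degree_le_maxDegree v
  obtain ⟨I, -, hI, hIw⟩ := BrooksWeight.exists_indep_weight hΔ hw Finset.univ
    (BrooksWeight.conn_univ hconn) (Finset.mem_univ a) (Finset.mem_univ b) hab hadj
    fun v _ => (hdeg v).trans_le (hle v)
  simp only [hdeg] at hIw
  calc
    _ = ∑ i ∈ Finset.Icc 1 Δ, ∑ v ∈ Finset.univ.filter (fun v : V => G.degree v = i),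
        Function.update c 0 1 (G.degree v) := Finset.sum_congr rfl fun i hi => by
      have hi1 := (Finset.mem_Icc.1 hi).1
      rw [Finset.sum_congr rfl fun v hv => by rw [(Finset.mem_filter.1 hv).2],
        Finset.sum_const, nsmul_eq_mul, mul_comm, Function.update_of_ne (by omega)]
    _ ≤ ∑ v, Function.update c 0 1 (G.degree v) := by
      rw [← Finset.sum_biUnion fun i _ j _ hij => Finset.disjoint_filter.2
        fun v _ h1 h2 => hij (h1.symm.trans h2)]
      exact Finset.sum_le_sum_of_subset_of_nonneg (Finset.subset_univ _)
        fun v _ _ => hw.nonneg (hle v)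
    _ ≤ I.card := hIw
    _ ≤ indepNum G := by exact_mod_cast BrooksWeight.card_le_indepNum hI
end

section
/- Let Δ ≥ 3 be an integer and let real numbers c_1, …, c_Δ satisfy c_Δ = 1/Δ and i·c_i + c_{i+1} = 1 for i = 1, …, Δ−1. Then for every ε > 0 and every j ∈ {1, …, Δ}, there exist infinitely many finite connected simple graphs G with maximum degree Δ, not isomorphic to K_{Δ+1}, such that α(G) < ε·|V_j(G)| + Σ_{i=1}^{Δ} c_i·|V_i(G)| (equivalently: for every natural number n there is such a graph G with |V(G)| > n for which the inequality α(G) ≥ ε·|V_j(G)| + Σ_{i=1}^{Δ} c_i·|V_i(G)| fails). -/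
/-- The graph on `Fin m` consisting of consecutive blocks of `Δ` vertices (the last one possibly
shorter), each inducing a clique, together with the edges joining consecutive vertices. -/
def cliqueChain (Δ m : ℕ) : SimpleGraph (Fin m) where
  Adj u v := u ≠ v ∧ (u.val / Δ = v.val / Δ ∨ u.val + 1 = v.val ∨ v.val + 1 = u.val)
  symm := ⟨fun u v h => ⟨h.1.symm, by omega⟩⟩
  loopless := ⟨fun u h => h.1 rfl⟩

theorem cliqueChain_connected (Δ m : ℕ) : (cliqueChain Δ (m + 1)).Connected := by
  refine (SimpleGraph.pathGraph_connected m).mono fun u v h => ?_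
  rw [SimpleGraph.pathGraph_adj] at h
  exact ⟨fun e => by subst e; omega, by omega⟩

/-- A vertex whose closed neighbourhood is the interval `[a, b]` has degree `b - a`. -/
theorem SimpleGraph.degree_eq_sub_of_adj_iff_mem_Icc {m : ℕ} (G : SimpleGraph (Fin m))
    (v : Fin m) [Fintype (G.neighborSet v)] {a b : ℕ} (hb : b < m) (hav : a ≤ v) (hvb : v ≤ b)
    (h : ∀ u, G.Adj v u ↔ u ≠ v ∧ a ≤ u.val ∧ u.val ≤ b) : G.degree v = b - a := by
  have hset : G.neighborFinset v
      = (Finset.Icc (⟨a, by omega⟩ : Fin m) ⟨b, hb⟩).erase v := by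
    ext u
    simp [h, Fin.le_def]
  rw [← G.card_neighborFinset_eq_degree, hset, Finset.card_erase_of_mem, Fin.card_Icc]
  · simp only
    omega
  · simp [Fin.le_def, hav, hvb]

section Degrees

variable {Δ N d : ℕ} (v : Fin (N * Δ + d + 1)) [Fintype ((cliqueChain Δ _).neighborSet v)]

theorem degree_cliqueChain_of_lt (hΔ : 3 ≤ Δ) (hv : v.val < N * Δ) :
    (cliqueChain Δ _).degree v = Δ - 1 ∨ (cliqueChain Δ _).degree v = Δ := by
  have hpos : 0 < Δ := by omega
  obtain ⟨k, hk⟩ : ∃ k, v.val / Δ = k := ⟨_, rfl⟩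
  have hk' := (Nat.div_eq_iff hpos).1 hk
  have hkN : (k + 1) * Δ ≤ N * Δ := by
    refine Nat.mul_le_mul_right _ ?_
    rw [← hk]
    exact (Nat.div_lt_iff_lt_mul hpos).2 hv
  rw [Nat.add_mul, one_mul] at hkN
  have hdeg := (cliqueChain Δ _).degree_eq_sub_of_adj_iff_mem_Icc v
    (a := if v.val = k * Δ then k * Δ - 1 else k * Δ)
    (b := if v.val = k * Δ + Δ - 1 then k * Δ + Δ else k * Δ + Δ - 1)
    (by split_ifs <;> omega) (by split_ifs <;> omega) (by split_ifs <;> omega) (fun u => by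
      simp only [cliqueChain, hk, eq_comm (a := k), ne_eq, Fin.ext_iff]
      simp only [Nat.div_eq_iff hpos]
      split_ifs <;> omega)
  rw [hdeg]
  split_ifs <;> omega

theorem degree_cliqueChain_of_val_eq_pred (hΔ : 3 ≤ Δ) (hN : 1 ≤ N) (hv : v.val = Δ - 1) :
    (cliqueChain Δ _).degree v = Δ := by
  have hpos : 0 < Δ := by omega
  have hN' : 1 * Δ ≤ N * Δ := Nat.mul_le_mul_right _ hN
  have hk : v.val / Δ = 0 := Nat.div_eq_of_lt (by omega)
  refine (SimpleGraph.degree_eq_sub_of_adj_iff_mem_Icc _ v (a := 0) (b := Δ)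
    (by omega) (by omega) (by omega) fun u => ?_).trans (by omega)
  simp only [cliqueChain, hk, eq_comm (a := 0), ne_eq, Fin.ext_iff]
  simp only [Nat.div_eq_iff hpos]
  omega

theorem degree_cliqueChain_of_eq (hN : 1 ≤ N) (hd : d + 1 ≤ Δ) (hv : v.val = N * Δ) :
    (cliqueChain Δ _).degree v = d + 1 := by
  have hpos : 0 < Δ := by omega
  have hN' : 1 * Δ ≤ N * Δ := Nat.mul_le_mul_right _ hN
  have hk : v.val / Δ = N := by rw [hv, Nat.mul_div_cancel _ hpos]
  refine (SimpleGraph.degree_eq_sub_of_adj_iff_mem_Icc _ v (a := N * Δ - 1) (b := N * Δ + d)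
    (by omega) (by omega) (by omega) fun u => ?_).trans (by omega)
  simp only [cliqueChain, hk, eq_comm (a := N), ne_eq, Fin.ext_iff]
  simp only [Nat.div_eq_iff hpos]
  omega

theorem degree_cliqueChain_of_gt (hd : d + 1 ≤ Δ) (hv : N * Δ < v.val) :
    (cliqueChain Δ _).degree v = d := by
  have hpos : 0 < Δ := by omega
  have hk : v.val / Δ = N := (Nat.div_eq_iff hpos).2 (by omega)
  refine (SimpleGraph.degree_eq_sub_of_adj_iff_mem_Icc _ v (a := N * Δ) (b := N * Δ + d)
    (by omega) (by omega) (by omega) fun u => ?_).trans (by omega)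
  simp only [cliqueChain, hk, eq_comm (a := N), ne_eq, Fin.ext_iff]
  simp only [Nat.div_eq_iff hpos]
  omega

end Degrees

theorem indepNum_cliqueChain_le {Δ N d : ℕ} (hd : d + 1 ≤ Δ) :
    indepNum (cliqueChain Δ (N * Δ + d + 1)) ≤ N + 1 := by
  refine csSup_le ⟨0, ∅, by simp [IsIndepSet], rfl⟩ ?_
  rintro _ ⟨s, hs, rfl⟩
  rw [← Finset.card_range (N + 1)]
  refine Finset.card_le_card_of_injOn (fun v => v.val / Δ) (fun v _ => ?_) fun u hu v hv h => ?_
  · simp only [Finset.coe_range, Set.mem_Iio]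
    rw [Nat.div_lt_iff_lt_mul (by omega), Nat.add_mul]
    omega
  · by_contra hne
    exact hs hu hv hne ⟨hne, Or.inl h⟩

/-- Summing a weight of the degree over the vertices, grouped by degree. -/
theorem SimpleGraph.sum_Icc_mul_card_degree_eq {V : Type*} [Fintype V] (G : SimpleGraph V)
    [DecidableRel G.Adj] {Δ : ℕ} (c : ℕ → ℝ) (h : ∀ v, 1 ≤ G.degree v ∧ G.degree v ≤ Δ) :
    ∑ i ∈ Finset.Icc 1 Δ, c i * ((Finset.univ.filter fun v => G.degree v = i).card : ℝ)
      = ∑ v, c (G.degree v) := by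
  rw [← Finset.sum_fiberwise_of_maps_to (t := Finset.Icc 1 Δ) (g := fun v => G.degree v)
    (fun v _ => Finset.mem_Icc.2 (h v))]
  refine Finset.sum_congr rfl fun i _ => ?_
  rw [Finset.sum_congr rfl fun v hv => by rw [(Finset.mem_filter.1 hv).2],
    Finset.sum_const, nsmul_eq_mul, mul_comm]

theorem sum_weight_degree_cliqueChain {Δ N d : ℕ} [DecidableRel (cliqueChain Δ (N * Δ + d + 1)).Adj]
    (hΔ : 3 ≤ Δ) (hN : 1 ≤ N) (hd : d + 1 ≤ Δ) (c : ℕ → ℝ) (hcΔ : c Δ = 1 / (Δ : ℝ))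
    (hcpred : c (Δ - 1) = 1 / (Δ : ℝ)) (hcd : (d : ℝ) * c d + c (d + 1) = 1) :
    ∑ v, c ((cliqueChain Δ (N * Δ + d + 1)).degree v) = N + 1 := by
  have hval : ∀ v : Fin (N * Δ + d + 1), c ((cliqueChain Δ _).degree v)
      = if v.val < N * Δ then 1 / (Δ : ℝ) else if v.val = N * Δ then c (d + 1) else c d := by
    intro v
    split_ifs with h₁ h₂
    · rcases degree_cliqueChain_of_lt v hΔ h₁ with h | h <;> rw [h] <;> assumption
    · rw [degree_cliqueChain_of_eq v hN hd h₂]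
    · rw [degree_cliqueChain_of_gt v hd (by omega)]
  have hΔ0 : (Δ : ℝ) ≠ 0 := by
    have : Δ ≠ 0 := by omega
    exact_mod_cast this
  rw [Finset.sum_congr rfl fun v _ => hval v, Fin.sum_univ_eq_sum_range
    (fun v => if v < N * Δ then 1 / (Δ : ℝ) else if v = N * Δ then c (d + 1) else c d),
    add_assoc, Finset.sum_range_add, Finset.sum_range_succ',
    Finset.sum_congr rfl fun v hv => if_pos (Finset.mem_range.1 hv)]
  simp
  field_simp
  linarith

open scoped Classical in
theorem stmt4 (Δ : ℕ) (hΔ : 3 ≤ Δ)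
    (c : ℕ → ℝ) (hcΔ : c Δ = 1 / (Δ : ℝ))
    (hrec : ∀ i : ℕ, 1 ≤ i → i ≤ Δ - 1 → (i : ℝ) * c i + c (i + 1) = 1)
    (ε : ℝ) (hε : 0 < ε) (j : ℕ) (hj1 : 1 ≤ j) (hj2 : j ≤ Δ) :
    ∀ n : ℕ, ∃ (m : ℕ) (G : SimpleGraph (Fin m)),
      n < m ∧ G.Connected ∧ G.maxDegree = Δ ∧
      ¬ Nonempty (G ≃g (⊤ : SimpleGraph (Fin (Δ + 1)))) ∧
      (indepNum G : ℝ) <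
        ε * ((Finset.univ.filter fun v : Fin m => G.degree v = j).card : ℝ) +
        ∑ i ∈ Finset.Icc 1 Δ,
          c i * ((Finset.univ.filter fun v : Fin m => G.degree v = i).card : ℝ) := by
  intro n
  obtain ⟨d, hd1, hdΔ, hjd⟩ : ∃ d, 1 ≤ d ∧ d + 1 ≤ Δ ∧ (j = Δ ∨ j = d) := by
    rcases hj2.eq_or_lt with h | h
    · exact ⟨1, le_rfl, by omega, Or.inl h⟩
    · exact ⟨j, hj1, h, Or.inr rfl⟩
  obtain ⟨N, hN⟩ : ∃ N, N = n + 2 := ⟨_, rfl⟩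
  have hNn : N * 3 ≤ N * Δ := Nat.mul_le_mul_left _ hΔ
  have hNΔ : 2 * Δ ≤ N * Δ := Nat.mul_le_mul_right _ (by omega)
  let G := cliqueChain Δ (N * Δ + d + 1)
  have hdeg : ∀ v, 1 ≤ G.degree v ∧ G.degree v ≤ Δ := by
    intro v
    rcases lt_trichotomy v.val (N * Δ) with h | h | h
    · have : G.degree v = Δ - 1 ∨ G.degree v = Δ := degree_cliqueChain_of_lt v hΔ h
      omega
    · have : G.degree v = d + 1 := degree_cliqueChain_of_eq v (by omega) hdΔ h
      omega
    · have : G.degree v = d := degree_cliqueChain_of_gt v hdΔ h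
      omega
  have hfull : G.degree ⟨Δ - 1, by omega⟩ = Δ :=
    degree_cliqueChain_of_val_eq_pred _ hΔ (by omega) rfl
  refine ⟨_, G, by omega, cliqueChain_connected _ _, le_antisymm ?_ ?_, ?_, ?_⟩
  · exact G.maxDegree_le_of_forall_degree_le Δ fun v => (hdeg v).2
  · exact hfull.symm.le.trans (G.degree_le_maxDegree _)
  · rintro ⟨e⟩
    have := Fintype.card_congr e.toEquiv
    simp only [Fintype.card_fin] at this
    omega
  · have hex : ∃ v, G.degree v = j := by
      rcases hjd with h | h
      · exact ⟨_, hfull.trans h.symm⟩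
      · exact ⟨⟨N * Δ + 1, by omega⟩, (degree_cliqueChain_of_gt _ hdΔ (by simp)).trans h.symm⟩
    have hpos : 0 < ((Finset.univ.filter fun v => G.degree v = j).card : ℝ) := by
      obtain ⟨v, hv⟩ := hex
      exact_mod_cast Finset.card_pos.2 ⟨v, by simpa using hv⟩
    have hcpred : c (Δ - 1) = 1 / (Δ : ℝ) := by
      obtain ⟨k, rfl⟩ : ∃ k, Δ = k + 1 := ⟨Δ - 1, by omega⟩
      have h := hrec k (by omega) (by omega)
      have hk : (0 : ℝ) < k := by
        have : 0 < k := by omega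
        exact_mod_cast this
      rw [hcΔ] at h
      simp only [Nat.add_sub_cancel]
      push_cast at h ⊢
      field_simp at h ⊢
      nlinarith
    rw [G.sum_Icc_mul_card_degree_eq c hdeg, sum_weight_degree_cliqueChain hΔ (by omega) hdΔ c hcΔ
      hcpred (hrec d hd1 (by omega))]
    have hα : (indepNum G : ℝ) ≤ N + 1 := by exact_mod_cast indepNum_cliqueChain_le hdΔ
    have := mul_pos hε hpos
    linarith
end

section
/- Let Δ ≥ 4 be an integer and let real numbers c_1, …, c_Δ satisfy c_Δ = 1/Δ and i·c_i + c_{i+1} = 1 for i = 1, …, Δ−1. Then for every i with 1 ≤ i ≤ Δ−3 one has c_i < (i+1)/(i·(i+2)). -/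
/-- A solution of the backward recursion `i * c i + c (i + 1) = 1` with `c Δ = 1 / Δ` satisfies
`0 < c i ≤ 1 / i`. -/
theorem pos_and_mul_le_one_of_recursion (Δ : ℕ) (c : ℕ → ℝ) (hcΔ : c Δ = 1 / (Δ : ℝ))
    (hrec : ∀ i : ℕ, 1 ≤ i → i ≤ Δ - 1 → (i : ℝ) * c i + c (i + 1) = 1)
    {i : ℕ} (hi : 1 ≤ i) (hiΔ : i ≤ Δ) : 0 < c i ∧ (i : ℝ) * c i ≤ 1 := by
  induction hiΔ using Nat.decreasingInduction with
  | self =>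
    have hpos : (0 : ℝ) < Δ := by exact_mod_cast hi
    rw [hcΔ]
    exact ⟨by positivity, (mul_one_div_cancel hpos.ne').le⟩
  | of_succ k hk ih =>
    obtain ⟨hpos, hle⟩ := ih (by omega)
    have hr := hrec k hi (by omega)
    have hk1 : (1 : ℝ) ≤ k := by exact_mod_cast hi
    push_cast at hle
    refine ⟨pos_of_mul_pos_right (a := (k : ℝ)) ?_ (by linarith), by linarith⟩
    nlinarith

theorem stmt9 (Δ : ℕ) (hΔ : 4 ≤ Δ)
    (c : ℕ → ℝ) (hcΔ : c Δ = 1 / (Δ : ℝ))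
    (hrec : ∀ i : ℕ, 1 ≤ i → i ≤ Δ - 1 → (i : ℝ) * c i + c (i + 1) = 1) :
    ∀ i : ℕ, 1 ≤ i → i ≤ Δ - 3 →
      c i < ((i : ℝ) + 1) / ((i : ℝ) * ((i : ℝ) + 2)) := by
  intro i hi hiΔ
  have hi1 : (1 : ℝ) ≤ i := by exact_mod_cast hi
  have hpos : 0 < c (i + 3) :=
    (pos_and_mul_le_one_of_recursion Δ c hcΔ hrec (by omega) (by omega)).1
  have h0 := hrec i hi (by omega)
  have h1 : ((i : ℝ) + 1) * c (i + 1) + c (i + 2) = 1 := by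
    exact_mod_cast hrec (i + 1) (by omega) (by omega)
  have h2 : ((i : ℝ) + 2) * c (i + 2) + c (i + 3) = 1 := by
    exact_mod_cast hrec (i + 2) (by omega) (by omega)
  have h3 : 1 < ((i : ℝ) + 2) * c (i + 1) := by
    refine lt_of_mul_lt_mul_left (a := (i : ℝ) + 1) ?_ (by linarith)
    linear_combination hpos - ((i : ℝ) + 2) * h1 + h2
  rw [lt_div_iff₀ (by positivity)]
  linear_combination h3 + ((i : ℝ) + 2) * h0
end

section
/- Let Δ ≥ 4 be an integer and let real numbers c_1, …, c_Δ satisfy c_Δ = 1/Δ and i·c_i + c_{i+1} = 1 for i = 1, …, Δ−1. Then c_{i+1} < c_i for every i with 1 ≤ i ≤ Δ−2. -/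
/-- Backward induction: a solution of `i * c i + c (i + 1) = 1` that ends in `(0, 1)`
stays in `(0, 1)`. -/
theorem mem_Ioo_of_backward_recursion {n : ℕ} {c : ℕ → ℝ} (hn : c n ∈ Set.Ioo (0 : ℝ) 1)
    (hrec : ∀ i : ℕ, 1 ≤ i → i < n → (i : ℝ) * c i + c (i + 1) = 1)
    {j : ℕ} (hj : 1 ≤ j) (hjn : j ≤ n) : c j ∈ Set.Ioo (0 : ℝ) 1 := by
  induction hjn using Nat.decreasingInduction with
  | self => exact hn
  | of_succ k hk ih =>
    obtain ⟨h0, h1⟩ := ih (by omega)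
    have h := hrec k hj hk
    have hk1 : (1 : ℝ) ≤ k := by exact_mod_cast hj
    have hpos : 0 < c k := pos_of_mul_pos_right (by linarith : 0 < (k : ℝ) * c k) (by linarith)
    exact ⟨hpos, by nlinarith⟩

theorem stmt10 (Δ : ℕ) (hΔ : 4 ≤ Δ)
    (c : ℕ → ℝ) (hcΔ : c Δ = 1 / (Δ : ℝ))
    (hrec : ∀ i : ℕ, 1 ≤ i → i ≤ Δ - 1 → (i : ℝ) * c i + c (i + 1) = 1) :
    ∀ i : ℕ, 1 ≤ i → i ≤ Δ - 2 → c (i + 1) < c i := by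
  intro i hi hiΔ
  have hΔ' : (4 : ℝ) ≤ Δ := by exact_mod_cast hΔ
  have hend : c Δ ∈ Set.Ioo (0 : ℝ) 1 := by
    rw [hcΔ]
    exact ⟨by positivity, by rw [div_lt_one] <;> linarith⟩
  have hpos : 0 < c (i + 2) := (mem_Ioo_of_backward_recursion hend
    (fun k hk hkΔ => hrec k hk (by omega)) (by omega) (by omega)).1
  have h₁ := hrec i hi (by omega)
  have h₂ := hrec (i + 1) (by omega) (by omega)
  push_cast at h₂
  have hi' : (1 : ℝ) ≤ i := by exact_mod_cast hi
  have hmul : (i : ℝ) * c (i + 1) < i * c i := by linarith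
  exact lt_of_mul_lt_mul_left hmul (by linarith)
end

section
/- Let Δ ≥ 4 be an integer and let real numbers c_1, …, c_Δ satisfy c_Δ = 1/Δ and i·c_i + c_{i+1} = 1 for i = 1, …, Δ−1. If 1 ≤ i ≤ Δ−2 and i ≡ Δ (mod 2), then c_i = 1/(i+1) + Σ_{j=1}^{(Δ−i−2)/2} (i+2j)/(i·(i+1)⋯(i+2j+1)) + 1/(i·(i+1)⋯Δ), where i·(i+1)⋯m denotes the product of the integers from i to m and an empty sum equals 0. -/
/-- Two steps of the recursion `i * c i + c (i + 1) = 1` combined into one. -/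
theorem eq_inv_add_div_of_mul_add_eq_one {c : ℕ → ℝ} {i : ℕ} (hi : 1 ≤ i)
    (h₀ : (i : ℝ) * c i + c (i + 1) = 1)
    (h₁ : ((i + 1 : ℕ) : ℝ) * c (i + 1) + c (i + 2) = 1) :
    c i = 1 / ((i : ℝ) + 1) + c (i + 2) / ((i : ℝ) * ((i : ℝ) + 1)) := by
  have hi' : (0 : ℝ) < i := by exact_mod_cast hi
  push_cast at h₁
  field_simp
  linear_combination ((i : ℝ) + 1) * h₀ - h₁

/-- The recursion `i * c i + c (i + 1) = 1` unrolled over `2 * n + 2` steps. -/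
theorem eq_inv_add_sum_add_div_prod {c : ℕ → ℝ} {i : ℕ} (hi : 1 ≤ i) (n : ℕ)
    (h : ∀ m, i ≤ m → m ≤ i + 2 * n + 1 → (m : ℝ) * c m + c (m + 1) = 1) :
    c i = 1 / ((i : ℝ) + 1)
      + (∑ j ∈ Finset.Icc 1 n,
          ((i : ℝ) + 2 * (j : ℝ)) / ∏ k ∈ Finset.Icc i (i + 2 * j + 1), (k : ℝ))
      + c (i + 2 * n + 2) / ∏ k ∈ Finset.Icc i (i + 2 * n + 1), (k : ℝ) := by
  induction n with
  | zero =>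
    have := eq_inv_add_div_of_mul_add_eq_one hi (h i le_rfl (by omega))
      (h (i + 1) (by omega) (by omega))
    simpa [Finset.prod_Icc_succ_top] using this
  | succ n ih =>
    have hstep := eq_inv_add_div_of_mul_add_eq_one (i := i + 2 * n + 2) (by omega)
      (h _ (by omega) (by omega)) (h _ (by omega) (by omega))
    rw [ih fun m hm hm' ↦ h m hm (by omega), Finset.sum_Icc_succ_top (by omega), hstep,
      show i + 2 * (n + 1) + 1 = i + 2 * n + 1 + 1 + 1 by ring,
      show i + 2 * (n + 1) + 2 = i + 2 * n + 2 + 2 by ring,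
      Finset.prod_Icc_succ_top (b := i + 2 * n + 1 + 1) (by omega),
      Finset.prod_Icc_succ_top (b := i + 2 * n + 1) (by omega)]
    have hP : (∏ k ∈ Finset.Icc i (i + 2 * n + 1), (k : ℝ)) ≠ 0 :=
      Finset.prod_ne_zero_iff.mpr fun k hk ↦ by
        have := (Finset.mem_Icc.mp hk).1
        exact_mod_cast (by omega : k ≠ 0)
    generalize (∏ k ∈ Finset.Icc i (i + 2 * n + 1), (k : ℝ)) = P at hP ⊢
    push_cast
    have h₂ : (i : ℝ) + 2 * n + 2 ≠ 0 := by positivity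
    have h₃ : (i : ℝ) + 2 * n + 2 + 1 ≠ 0 := by positivity
    rw [show (i : ℝ) + 2 * n + 1 + 1 = i + 2 * n + 2 by ring,
      show (i : ℝ) + 2 * (n + 1) = i + 2 * n + 2 by ring]
    generalize (i : ℝ) + 2 * n + 2 = m at h₂ h₃ ⊢
    field_simp
    ring

theorem stmt11 (Δ : ℕ) (hΔ : 4 ≤ Δ)
    (c : ℕ → ℝ) (hcΔ : c Δ = 1 / (Δ : ℝ))
    (hrec : ∀ i : ℕ, 1 ≤ i → i ≤ Δ - 1 → (i : ℝ) * c i + c (i + 1) = 1)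
    (i : ℕ) (hi1 : 1 ≤ i) (hi2 : i ≤ Δ - 2) (hpar : i % 2 = Δ % 2) :
    c i = 1 / ((i : ℝ) + 1)
      + (∑ j ∈ Finset.Icc 1 ((Δ - i - 2) / 2),
          ((i : ℝ) + 2 * (j : ℝ)) / ∏ k ∈ Finset.Icc i (i + 2 * j + 1), (k : ℝ))
      + 1 / ∏ k ∈ Finset.Icc i Δ, (k : ℝ) := by
  obtain ⟨n, rfl⟩ : ∃ n, Δ = i + 2 * n + 2 := ⟨(Δ - i - 2) / 2, by omega⟩
  have key := eq_inv_add_sum_add_div_prod hi1 n fun m hm hm' ↦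
    hrec m (by omega) (by omega)
  rw [hcΔ, div_div, mul_comm, ← Finset.prod_Icc_succ_top (b := i + 2 * n + 1) (by omega)] at key
  rw [show (i + 2 * n + 2 - i - 2) / 2 = n by omega]
  exact key
end

section
/- Let Δ ≥ 4 be an integer and let real numbers c_1, …, c_Δ satisfy c_Δ = 1/Δ and i·c_i + c_{i+1} = 1 for i = 1, …, Δ−1. If 1 ≤ i ≤ Δ−3 and i ≡ Δ−1 (mod 2), then c_i = 1/(i+1) + Σ_{j=1}^{(Δ−i−3)/2} (i+2j)/(i·(i+1)⋯(i+2j+1)) + (Δ−1)/(i·(i+1)⋯Δ), where i·(i+1)⋯m denotes the product of the integers from i to m and an empty sum equals 0. -/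
/-- Two steps of the recursion `i * c i + c (i + 1) = 1` combined. -/
theorem eq_of_two_steps (c : ℕ → ℝ) (i : ℕ) (hi : 1 ≤ i)
    (h₀ : (i : ℝ) * c i + c (i + 1) = 1)
    (h₁ : ((i + 1 : ℕ) : ℝ) * c (i + 1) + c (i + 2) = 1) :
    c i = 1 / ((i : ℝ) + 1) + c (i + 2) / ((i : ℝ) * ((i : ℝ) + 1)) := by
  have hpos : (0 : ℝ) < i := by exact_mod_cast hi
  push_cast at h₁
  field_simp
  linear_combination ((i : ℝ) + 1) * h₀ - h₁

theorem prod_Icc_eq_mul_mul_prod_Icc_add_two (i m : ℕ) (h : i + 1 ≤ m) :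
    ∏ k ∈ Finset.Icc i m, (k : ℝ) =
      (i : ℝ) * ((i : ℝ) + 1) * ∏ k ∈ Finset.Icc (i + 2) m, (k : ℝ) := by
  rw [← Finset.insert_Icc_add_one_left_eq_Icc (show i ≤ m by omega),
    Finset.prod_insert (by simp), ← Finset.insert_Icc_add_one_left_eq_Icc h,
    Finset.prod_insert (by simp), add_assoc i 1 1, one_add_one_eq_two]
  push_cast
  ring

/-- The closed form, with the end index of the recursion written as `i + 2 * n + 3`. -/
theorem eq_closed_form_of_rec (c : ℕ → ℝ) (n i : ℕ) (hi : 1 ≤ i)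
    (hend : c (i + 2 * n + 3) = 1 / ((i + 2 * n + 3 : ℕ) : ℝ))
    (hrec : ∀ m : ℕ, i ≤ m → m ≤ i + 2 * n + 2 → (m : ℝ) * c m + c (m + 1) = 1) :
    c i = 1 / ((i : ℝ) + 1)
      + (∑ j ∈ Finset.Icc 1 n,
          ((i : ℝ) + 2 * (j : ℝ)) / ∏ k ∈ Finset.Icc i (i + 2 * j + 1), (k : ℝ))
      + (((i + 2 * n + 3 : ℕ) : ℝ) - 1) / ∏ k ∈ Finset.Icc i (i + 2 * n + 3), (k : ℝ) := by
  have hpos : (0 : ℝ) < i := by exact_mod_cast hi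
  rw [eq_of_two_steps c i hi (hrec i le_rfl (by omega)) (hrec (i + 1) (by omega) (by omega))]
  induction n generalizing i with
  | zero =>
    have h₂ := hrec (i + 2) (by omega) (by omega)
    simp only [mul_zero, add_zero] at hend
    rw [hend] at h₂
    rw [prod_Icc_eq_mul_mul_prod_Icc_add_two _ _ (by omega),
      prod_Icc_eq_mul_mul_prod_Icc_add_two _ _ (by omega)]
    simp only [mul_zero, add_zero]
    rw [Finset.Icc_eq_empty (a := i + 2 + 2) (by omega)]
    push_cast at h₂ ⊢
    have hc : c (i + 2) = (1 - 1 / ((i : ℝ) + 3)) / ((i : ℝ) + 2) := by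
      rw [eq_div_iff (by positivity)]
      linear_combination h₂
    rw [hc]
    simp
    field_simp
    ring
  | succ n ih =>
    have h := ih (i + 2) (by omega) (by rwa [show i + 2 + 2 * n + 3 = i + 2 * (n + 1) + 3 by ring])
      (fun m h₁ h₂ => hrec m (by omega) (by omega)) (by positivity)
    rw [← eq_of_two_steps c (i + 2) (by omega) (hrec (i + 2) (by omega) (by omega))
      (hrec (i + 2 + 1) (by omega) (by omega))] at h
    have hfirst : ((i : ℝ) + 2 * ((1 : ℕ) : ℝ)) / ∏ k ∈ Finset.Icc i (i + 2 * 1 + 1), (k : ℝ)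
        = 1 / ((i : ℝ) + 2 + 1) / ((i : ℝ) * ((i : ℝ) + 1)) := by
      rw [prod_Icc_eq_mul_mul_prod_Icc_add_two _ _ (by omega),
        prod_Icc_eq_mul_mul_prod_Icc_add_two _ _ (by omega), Finset.Icc_eq_empty (by omega)]
      push_cast
      simp only [Finset.prod_empty]
      field_simp
    have hshift : ∑ j ∈ Finset.Icc (1 + 1) (n + 1),
          ((i : ℝ) + 2 * (j : ℝ)) / ∏ k ∈ Finset.Icc i (i + 2 * j + 1), (k : ℝ)
        = (∑ j ∈ Finset.Icc 1 n, (((i + 2 : ℕ) : ℝ) + 2 * (j : ℝ)) /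
            ∏ k ∈ Finset.Icc (i + 2) (i + 2 + 2 * j + 1), (k : ℝ))
          / ((i : ℝ) * ((i : ℝ) + 1)) := by
      rw [← Finset.map_add_right_Icc, Finset.sum_map, Finset.sum_div]
      refine Finset.sum_congr rfl fun j _ => ?_
      rw [addRightEmbedding_apply, prod_Icc_eq_mul_mul_prod_Icc_add_two i _ (by omega),
        show i + 2 * (j + 1) + 1 = i + 2 + 2 * j + 1 by ring, div_div, mul_comm (∏ k ∈ _, _)]
      push_cast
      ring
    rw [h, prod_Icc_eq_mul_mul_prod_Icc_add_two i _ (by omega),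
      show i + 2 * (n + 1) + 3 = i + 2 + 2 * n + 3 by ring,
      ← Finset.insert_Icc_add_one_left_eq_Icc (show 1 ≤ n + 1 by omega),
      Finset.sum_insert (by simp), hfirst, hshift, add_div, add_div, div_div _ (∏ k ∈ _, _),
      mul_comm (∏ k ∈ _, _)]
    push_cast
    ring

theorem stmt12 (Δ : ℕ) (hΔ : 4 ≤ Δ)
    (c : ℕ → ℝ) (hcΔ : c Δ = 1 / (Δ : ℝ))
    (hrec : ∀ i : ℕ, 1 ≤ i → i ≤ Δ - 1 → (i : ℝ) * c i + c (i + 1) = 1)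
    (i : ℕ) (hi1 : 1 ≤ i) (hi2 : i ≤ Δ - 3) (hpar : i % 2 = (Δ - 1) % 2) :
    c i = 1 / ((i : ℝ) + 1)
      + (∑ j ∈ Finset.Icc 1 ((Δ - i - 3) / 2),
          ((i : ℝ) + 2 * (j : ℝ)) / ∏ k ∈ Finset.Icc i (i + 2 * j + 1), (k : ℝ))
      + ((Δ : ℝ) - 1) / ∏ k ∈ Finset.Icc i Δ, (k : ℝ) := by
  obtain ⟨n, rfl⟩ : ∃ n, Δ = i + 2 * n + 3 := ⟨(Δ - i - 3) / 2, by omega⟩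
  rw [show (i + 2 * n + 3 - i - 3) / 2 = n by omega]
  exact eq_closed_form_of_rec c n i hi1 hcΔ fun m h₁ h₂ => hrec m (by omega) (by omega)
end

section
/- Let Δ ≥ 4 be an integer, let G be a finite connected simple graph with maximum degree Δ not isomorphic to K_{Δ+1}, and suppose the minimum degree δ of G satisfies δ ≤ Δ−1. Let real numbers c_1, …, c_Δ satisfy c_Δ = 1/Δ and i·c_i + c_{i+1} = 1 for i = 1, …, Δ−1, and set f_G(v) = c_{d_G(v)} for each vertex v of G. Then there exists a vertex u of degree δ such that f_G(u) + Σ_{w ∈ N_G(u)} f_G(w) ≤ 1. -/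
/-- A sequence with `i * c i + c (i + 1) = 1` whose last term is `1 / Δ` satisfies
`0 ≤ c i ≤ 1 / i`, written without division. -/
theorem nonneg_and_mul_le_one_of_rec {Δ : ℕ} (hΔ : 1 ≤ Δ) {c : ℕ → ℝ}
    (hcΔ : c Δ = 1 / (Δ : ℝ))
    (hrec : ∀ i : ℕ, 1 ≤ i → i ≤ Δ - 1 → (i : ℝ) * c i + c (i + 1) = 1)
    {i : ℕ} (hi : 1 ≤ i) (hiΔ : i ≤ Δ) : 0 ≤ c i ∧ (i : ℝ) * c i ≤ 1 := by
  induction hiΔ using Nat.decreasingInduction with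
  | self =>
    have : (0 : ℝ) < Δ := by exact_mod_cast hΔ
    rw [hcΔ]
    exact ⟨by positivity, by field_simp; rfl⟩
  | of_succ k hk ih =>
    obtain ⟨h0, h1⟩ := ih (by omega)
    have hr := hrec k hi (by omega)
    have hk0 : (0 : ℝ) < k := by exact_mod_cast hi
    push_cast at h1
    have h2 : 0 ≤ (k : ℝ) * c k := by nlinarith
    exact ⟨nonneg_of_mul_nonneg_right h2 hk0, by linarith⟩

theorem le_of_rec {Δ : ℕ} (hΔ : 1 ≤ Δ) {c : ℕ → ℝ} (hcΔ : c Δ = 1 / (Δ : ℝ))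
    (hrec : ∀ i : ℕ, 1 ≤ i → i ≤ Δ - 1 → (i : ℝ) * c i + c (i + 1) = 1)
    {i j : ℕ} (hi : 1 ≤ i) (hij : i ≤ j) (hj : j ≤ Δ) : c j ≤ c i := by
  induction j, hij using Nat.le_induction with
  | base => rfl
  | succ k hk ih =>
    refine le_trans ?_ (ih (by omega))
    have hr := hrec k (by omega) (by omega)
    have h1 := (nonneg_and_mul_le_one_of_rec hΔ hcΔ hrec (i := k + 1) (by omega) hj).2
    have hk0 : (0 : ℝ) < k := by exact_mod_cast (by omega : 0 < k)
    push_cast at h1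
    exact le_of_mul_le_mul_left (by linarith) hk0

/-- In a connected graph that is not regular, some vertex of minimum degree has a neighbour of
larger degree. -/
theorem SimpleGraph.Connected.exists_adj_minDegree_lt_degree {V : Type*} [Fintype V]
    {G : SimpleGraph V} [DecidableRel G.Adj] (hconn : G.Connected)
    (hlt : G.minDegree < G.maxDegree) :
    ∃ u v : V, G.Adj u v ∧ G.degree u = G.minDegree ∧ G.minDegree < G.degree v := by
  have := hconn.nonempty
  obtain ⟨a, ha⟩ := G.exists_minimal_degree_vertex
  obtain ⟨b, hb⟩ := G.exists_maximal_degree_vertex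
  obtain ⟨p⟩ := hconn.preconnected a b
  obtain ⟨d, -, h1, h2⟩ := p.exists_boundary_dart {v | G.degree v = G.minDegree}
    ha.symm (fun h : G.degree b = G.minDegree => by omega)
  exact ⟨d.fst, d.snd, d.adj, h1, lt_of_le_of_ne (G.minDegree_le_degree _) (Ne.symm h2)⟩


theorem stmt13 (Δ : ℕ) (hΔ : 4 ≤ Δ) {V : Type*} [Fintype V]
    (G : SimpleGraph V) [DecidableRel G.Adj]
    (hconn : G.Connected) (hmax : G.maxDegree = Δ)
    (hnotK : ¬ Nonempty (G ≃g (⊤ : SimpleGraph (Fin (Δ + 1)))))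
    (hmin : G.minDegree ≤ Δ - 1)
    (c : ℕ → ℝ) (hcΔ : c Δ = 1 / (Δ : ℝ))
    (hrec : ∀ i : ℕ, 1 ≤ i → i ≤ Δ - 1 → (i : ℝ) * c i + c (i + 1) = 1) :
    ∃ u : V, G.degree u = G.minDegree ∧
      c (G.degree u) + ∑ w ∈ G.neighborFinset u, c (G.degree w) ≤ 1 := by
  classical
  obtain ⟨u, v, huv, hu, hv⟩ := hconn.exists_adj_minDegree_lt_degree (by omega)
  refine ⟨u, hu, ?_⟩
  have hpos : 1 ≤ G.degree u := (G.degree_pos_iff_exists_adj u).2 ⟨v, huv⟩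
  have hle : ∀ w, G.degree w ≤ Δ := fun w => hmax ▸ G.degree_le_maxDegree w
  have hmem : v ∈ G.neighborFinset u := by simpa using huv
  have hv' : c (G.degree v) ≤ c (G.degree u + 1) :=
    le_of_rec (by omega) hcΔ hrec (by omega) (by omega) (hle v)
  have hsum : ∑ w ∈ (G.neighborFinset u).erase v, c (G.degree w)
      ≤ ((G.neighborFinset u).erase v).card • c (G.degree u) :=
    Finset.sum_le_card_nsmul _ _ _ fun w _ =>
      le_of_rec (by omega) hcΔ hrec hpos (hu ▸ G.minDegree_le_degree w) (hle w)
  rw [Finset.card_erase_of_mem hmem, G.card_neighborFinset_eq_degree, nsmul_eq_mul,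
    Nat.cast_sub hpos, Nat.cast_one] at hsum
  rw [← Finset.add_sum_erase _ _ hmem]
  have hr := hrec (G.degree u) hpos (by omega)
  linarith
end

section
/- Let Δ ≥ 4 be an integer and let real numbers c_1, …, c_Δ satisfy c_Δ = 1/Δ and i·c_i + c_{i+1} = 1 for i = 1, …, Δ−1. Then c_i ≤ 2/(2i+1) for every i with 1 ≤ i ≤ Δ−1, and c_i = min{(1 − c_{i+1})/i, 2/(2i+1)} for every i with 1 ≤ i ≤ Δ−2. -/
/-- The upper bound `2 / (2 i + 1)` at `i` follows from the lower bound `1 / (2 i + 1)` at the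
next index. -/
theorem le_of_mul_add_eq_one {x a b : ℝ} (hx : 1 ≤ x) (h : x * a + b = 1)
    (hb : 1 / (2 * x + 1) ≤ b) : a ≤ 2 / (2 * x + 1) := by
  rw [div_le_iff₀ (by linarith)] at hb
  rw [le_div_iff₀ (by linarith)]
  refine le_of_mul_le_mul_left ?_ (by linarith : 0 < x)
  nlinarith

/-- The lower bound `1 / (2 i - 1)` at `i ≥ 2` follows from the upper bound `2 / (2 i + 3)` at the
next index. -/
theorem ge_of_mul_add_eq_one {x a b : ℝ} (hx : 2 ≤ x) (h : x * a + b = 1)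
    (hb : b ≤ 2 / (2 * x + 3)) : 1 / (2 * x - 1) ≤ a := by
  have hbound : 2 / (2 * x + 3) ≤ (x - 1) / (2 * x - 1) := by
    rw [div_le_div_iff₀ (by linarith) (by linarith)]
    nlinarith
  have hb' := hb.trans hbound
  rw [le_div_iff₀ (by linarith)] at hb'
  rw [div_le_iff₀ (by linarith)]
  refine le_of_mul_le_mul_left ?_ (by linarith : 0 < x)
  nlinarith

/-- Two-sided bounds for the recursion `i * c i + c (i + 1) = 1` with `c Δ = 1 / Δ`, at the
indices `2 ≤ i < Δ`. -/
theorem recursion_bounds {Δ : ℕ} {c : ℕ → ℝ} (hcΔ : c Δ = 1 / (Δ : ℝ))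
    (hrec : ∀ i : ℕ, 1 ≤ i → i ≤ Δ - 1 → (i : ℝ) * c i + c (i + 1) = 1)
    (d i : ℕ) (hi : 2 ≤ i) (hd : i + 1 + d = Δ) :
    1 / (2 * (i : ℝ) - 1) ≤ c i ∧ c i ≤ 2 / (2 * (i : ℝ) + 1) := by
  have hi' : (2 : ℝ) ≤ i := by exact_mod_cast hi
  have h := hrec i (by omega) (by omega)
  induction d generalizing i with
  | zero =>
    obtain rfl : i + 1 = Δ := hd
    have hc : c i = 1 / ((i : ℝ) + 1) := by
      rw [hcΔ] at h
      push_cast at h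
      field_simp at h ⊢
      refine mul_left_cancel₀ (by positivity : (i : ℝ) ≠ 0) ?_
      linarith
    rw [hc]
    constructor
    · exact one_div_le_one_div_of_le (by linarith) (by linarith)
    · rw [div_le_div_iff₀ (by linarith) (by linarith)]
      linarith
  | succ d ih =>
    obtain ⟨hl, hu⟩ := ih (i + 1) (by omega) (by omega) (by push_cast; linarith)
      (hrec (i + 1) (by omega) (by omega))
    push_cast at hl hu
    constructor
    · exact ge_of_mul_add_eq_one hi' h (by convert hu using 2; ring)
    · exact le_of_mul_add_eq_one (by linarith) h (by convert hl using 2; ring)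

theorem stmt16 (Δ : ℕ) (hΔ : 4 ≤ Δ)
    (c : ℕ → ℝ) (hcΔ : c Δ = 1 / (Δ : ℝ))
    (hrec : ∀ i : ℕ, 1 ≤ i → i ≤ Δ - 1 → (i : ℝ) * c i + c (i + 1) = 1) :
    (∀ i : ℕ, 1 ≤ i → i ≤ Δ - 1 → c i ≤ 2 / (2 * (i : ℝ) + 1)) ∧
    (∀ i : ℕ, 1 ≤ i → i ≤ Δ - 2 →
      c i = min ((1 - c (i + 1)) / (i : ℝ)) (2 / (2 * (i : ℝ) + 1))) := by
  have hle : ∀ i : ℕ, 1 ≤ i → i ≤ Δ - 1 → c i ≤ 2 / (2 * (i : ℝ) + 1) := by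
    intro i h1 h2
    rcases h1.eq_or_lt with rfl | h1
    · have hl := (recursion_bounds hcΔ hrec (Δ - 3) 2 le_rfl (by omega)).1
      refine le_of_mul_add_eq_one (by norm_num) (hrec 1 le_rfl h2) ?_
      norm_num at hl ⊢
      exact hl
    · exact (recursion_bounds hcΔ hrec (Δ - 1 - i) i h1 (by omega)).2
  refine ⟨hle, fun i h1 h2 => ?_⟩
  have hpos : (0 : ℝ) < i := by exact_mod_cast h1
  have hc : (1 - c (i + 1)) / (i : ℝ) = c i := by
    rw [div_eq_iff hpos.ne']
    linarith [hrec i h1 (by omega)]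
  rw [hc, min_eq_left (hle i h1 (by omega))]
end

section
/- For every even integer i ≥ 2, the infinite series Σ_{j=1}^{∞} 1/(i·(i+1)⋯(i+2j)) converges and equals (i−1)!·((e + 1/e)/2 − Σ_{j=0}^{i/2} 1/(2j)!), and the infinite series Σ_{j=1}^{∞} 1/(i·(i+1)⋯(i+2j+1)) converges and equals (i−1)!·((e − 1/e)/2 − Σ_{j=0}^{i/2} 1/(2j+1)!). -/
theorem one_div_prod_Icc_cast {i : ℕ} (hi : 1 ≤ i) (n : ℕ) :
    1 / ∏ k ∈ Finset.Icc i (i + n), (k : ℝ) =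
      (Nat.factorial (i - 1) : ℝ) * (1 / (Nat.factorial (i + n) : ℝ)) := by
  have key : (Nat.factorial (i - 1) : ℝ) * ∏ k ∈ Finset.Icc i (i + n), (k : ℝ) =
      (Nat.factorial (i + n) : ℝ) := by
    induction n with
    | zero => simpa [mul_comm] using congrArg (Nat.cast (R := ℝ)) (Nat.mul_factorial_pred (by lia : i ≠ 0))
    | succ n ih =>
      rw [← add_assoc, Finset.prod_Icc_succ_top (by lia), ← mul_assoc, ih, Nat.factorial_succ]
      push_cast
      ring
  have h : (Nat.factorial (i - 1) : ℝ) ≠ 0 := by positivity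
  rw [← key, mul_one_div, ← div_div, div_self h]

theorem stmt17 (i : ℕ) (hi : 2 ≤ i) (heven : Even i) :
    HasSum (fun j : ℕ => 1 / ∏ k ∈ Finset.Icc i (i + 2 * (j + 1)), (k : ℝ))
      ((Nat.factorial (i - 1) : ℝ) *
        ((Real.exp 1 + 1 / Real.exp 1) / 2
          - ∑ j ∈ Finset.range (i / 2 + 1), 1 / (Nat.factorial (2 * j) : ℝ))) ∧
    HasSum (fun j : ℕ => 1 / ∏ k ∈ Finset.Icc i (i + 2 * (j + 1) + 1), (k : ℝ))
      ((Nat.factorial (i - 1) : ℝ) *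
        ((Real.exp 1 - 1 / Real.exp 1) / 2
          - ∑ j ∈ Finset.range (i / 2 + 1), 1 / (Nat.factorial (2 * j + 1) : ℝ))) := by
  have hcosh := Real.hasSum_cosh 1
  have hsinh := Real.hasSum_sinh 1
  simp only [one_pow, Real.cosh_eq, Real.sinh_eq, Real.exp_neg, ← one_div] at hcosh hsinh
  have hhalf : 2 * (i / 2) = i := Nat.two_mul_div_two_of_even heven
  constructor
  · convert! ((hasSum_nat_add_iff' (i / 2 + 1)).2 hcosh).mul_left (Nat.factorial (i - 1) : ℝ)
      using 2 with j
    rw [one_div_prod_Icc_cast (by lia), show 2 * (j + (i / 2 + 1)) = i + 2 * (j + 1) by lia]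
  · convert! ((hasSum_nat_add_iff' (i / 2 + 1)).2 hsinh).mul_left (Nat.factorial (i - 1) : ℝ)
      using 2 with j
    rw [add_assoc, one_div_prod_Icc_cast (by lia),
      show 2 * (j + (i / 2 + 1)) + 1 = i + (2 * (j + 1) + 1) by lia]
end

section
/- For every integer i ≥ 1, the infinite series 1/(i+1) + Σ_{j=1}^{∞} (i+2j)/(i·(i+1)⋯(i+2j+1)) converges and equals d_i, where d_i = 1/(i+1) + (i−1)!·(1/e − Σ_{j=0}^{i+1} (−1)^j/j!) if i is even and d_i = 1/(i+1) + (i−1)!·(Σ_{j=0}^{i+1} (−1)^j/j! − 1/e) if i is odd. -/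
/-- The coefficients `d_i`. -/
noncomputable def dcoef (i : ℕ) : ℝ :=
  if Even i then
    1 / ((i : ℝ) + 1) + (Nat.factorial (i - 1) : ℝ) *
      (1 / Real.exp 1 - ∑ j ∈ Finset.range (i + 2), (-1 : ℝ) ^ j / (Nat.factorial j : ℝ))
  else
    1 / ((i : ℝ) + 1) + (Nat.factorial (i - 1) : ℝ) *
      (∑ j ∈ Finset.range (i + 2), (-1 : ℝ) ^ j / (Nat.factorial j : ℝ) - 1 / Real.exp 1)

open Filter Topology in
theorem tendsto_sum_range_neg_one_pow_div_factorial :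
    Tendsto (fun n : ℕ => ∑ j ∈ Finset.range n, (-1 : ℝ) ^ j / (Nat.factorial j : ℝ)) atTop
      (𝓝 (1 / Real.exp 1)) := by
  have h := (NormedSpace.expSeries_div_hasSum_exp (-1 : ℝ)).tendsto_sum_nat
  rwa [← Real.exp_eq_exp_ℝ, Real.exp_neg, ← one_div] at h

theorem prod_Icc_cast_mul_factorial (i n : ℕ) (hi : 1 ≤ i) :
    (∏ k ∈ Finset.Icc i (i + n), (k : ℝ)) * ((i - 1).factorial : ℝ) = ((i + n).factorial : ℝ) := by
  induction n with
  | zero =>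
    obtain ⟨m, rfl⟩ := Nat.exists_eq_add_of_le' hi
    simp [Nat.factorial_succ]
  | succ n ih =>
    rw [← Nat.add_assoc, Finset.prod_Icc_succ_top (by omega), Nat.factorial_succ, Nat.cast_mul, ← ih]
    ring

theorem dcoef_eq (i : ℕ) :
    dcoef i = 1 / ((i : ℝ) + 1) + (Nat.factorial (i - 1) : ℝ) * ((-1) ^ i *
      (1 / Real.exp 1 - ∑ j ∈ Finset.range (i + 2), (-1 : ℝ) ^ j / (Nat.factorial j : ℝ))) := by
  unfold dcoef
  split_ifs with h
  · rw [h.neg_one_pow]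
    ring
  · rw [(Nat.not_even_iff_odd.mp h).neg_one_pow]
    ring

theorem div_prod_Icc_eq (i j : ℕ) (hi : 1 ≤ i) :
    ((i : ℝ) + 2 * (j : ℝ)) / ∏ k ∈ Finset.Icc i (i + 2 * j + 1), (k : ℝ) =
      (Nat.factorial (i - 1) : ℝ) * ((-1) ^ i *
        ((-1) ^ (i + 2 * j) / (Nat.factorial (i + 2 * j) : ℝ) +
          (-1) ^ (i + 2 * j + 1) / (Nat.factorial (i + 2 * j + 1) : ℝ))) := by
  have hprod := prod_Icc_cast_mul_factorial i (2 * j + 1) hi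
  rw [← Nat.add_assoc] at hprod
  have hm : ((i - 1).factorial : ℝ) ≠ 0 := by positivity
  have hf : ((i + 2 * j).factorial : ℝ) ≠ 0 := by positivity
  have hs : (i : ℝ) + 2 * j + 1 ≠ 0 := by positivity
  have hsq : ((-1 : ℝ) ^ i) * (-1) ^ i = 1 := by rw [← mul_pow]; norm_num
  rw [eq_div_of_mul_eq hm hprod, Nat.factorial_succ, pow_succ, pow_add, pow_mul]
  push_cast
  field_simp
  norm_num
  linear_combination (-(i : ℝ) - 2 * j) * hsq

/-- The series `1/(i+1) + Σ_{j≥1} (i+2j)/(i·(i+1)⋯(i+2j+1))` (the `j = 0` term of the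
summand below is the constant `1/(i+1)`) converges and has sum `d_i`. -/
theorem stmt19 (i : ℕ) (hi : 1 ≤ i) :
    HasSum (fun j : ℕ =>
        if j = 0 then 1 / ((i : ℝ) + 1)
        else ((i : ℝ) + 2 * (j : ℝ)) / ∏ k ∈ Finset.Icc i (i + 2 * j + 1), (k : ℝ))
      (dcoef i) := by
  have hpartial (n : ℕ) : ∑ j ∈ Finset.range (n + 1),
      (if j = 0 then 1 / ((i : ℝ) + 1)
        else ((i : ℝ) + 2 * (j : ℝ)) / ∏ k ∈ Finset.Icc i (i + 2 * j + 1), (k : ℝ)) =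
      1 / ((i : ℝ) + 1) + (Nat.factorial (i - 1) : ℝ) * ((-1) ^ i *
        (∑ j ∈ Finset.range (i + 2 * n + 2), (-1 : ℝ) ^ j / (Nat.factorial j : ℝ) -
          ∑ j ∈ Finset.range (i + 2), (-1 : ℝ) ^ j / (Nat.factorial j : ℝ))) := by
    induction n with
    | zero => simp
    | succ n ih =>
      rw [Finset.sum_range_succ, ih, if_neg n.succ_ne_zero, div_prod_Icc_eq i (n + 1) hi,
        Finset.sum_range_succ _ (i + 2 * (n + 1) + 1), Finset.sum_range_succ _ (i + 2 * (n + 1)),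
        show i + 2 * (n + 1) = i + 2 * n + 2 by ring]
      ring
  rw [hasSum_iff_tendsto_nat_of_nonneg (fun j => by split_ifs <;> positivity),
    ← Filter.tendsto_add_atTop_iff_nat 1, dcoef_eq]
  simp_rw [hpartial]
  have hindex : Filter.Tendsto (fun n : ℕ => i + 2 * n + 2) Filter.atTop Filter.atTop :=
    Filter.tendsto_atTop_mono (fun n => by simp only [id]; omega) Filter.tendsto_id
  exact ((((tendsto_sum_range_neg_one_pow_div_factorial.comp hindex).sub_const _).const_mul
    _).const_mul _).const_add _
end
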